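/- Let ∼ be a measurable equivalence relation on the set R of rays of T'_m, let 0≤p≤1 and q>0, and let π=p/(p+q(1−p)). (a) A probability measure φ on (Ω,F) satisfies φ∈R^∼_{p,q} if and only if, for every edge e∈E and φ-almost every ξ, φ(J_e|T_e)(ξ) equals p if ξ∈K^∼_e and equals π if ξ∉K^∼_e. (b) If moreover p∉{0,1} and q≠1, and φ∈R^∼_{p,q}, then for e∈E the state of e is independent (under φ) of the states of all other edges and equals 1 with probability π, if and only if φ(K^∼_e)=0. -/

import Mathlib

namespace RCTree

abbrev Edge (m : ℕ) := Fin (m + 1) × List (Fin m)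
abbrev V (m : ℕ) := Option (Edge m)
abbrev Ray (m : ℕ) := Fin (m + 1) × (ℕ → Fin m)
abbrev Config (m : ℕ) := Edge m → Bool

variable {m : ℕ}

/-- The vertex at the top (towards the root) of an edge. -/
def parentV (e : Edge m) : V m :=
  if e.2 = [] then none else some (e.1, e.2.dropLast)

/-- The vertex at the bottom (away from the root) of an edge. -/
def childV (e : Edge m) : V m := some e

/-- The (undirected) edge `e` has endvertices `u` and `v`. -/
def EndsAt (e : Edge m) (u v : V m) : Prop :=
  (parentV e = u ∧ childV e = v) ∨ (parentV e = v ∧ childV e = u)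

/-- The `n`-th edge of a ray from the root. -/
def rayEdge (ρ : Ray m) (n : ℕ) : Edge m := (ρ.1, List.ofFn fun k : Fin n => ρ.2 k)

/-- The `n`-th vertex of a ray from the root. -/
def rayVtx (ρ : Ray m) : ℕ → V m
  | 0 => none
  | n + 1 => some (rayEdge ρ n)

def rayEdges (ρ : Ray m) : Set (Edge m) := Set.range (rayEdge ρ)

/-- The ray `ρ` passes through the vertex `v`. -/
def RayThrough (ρ : Ray m) (v : V m) : Prop := ∃ n, rayVtx ρ n = v

/-- All edges of the ray `ρ` are open in `ω`. -/
def OpenRay (ω : Config m) (ρ : Ray m) : Prop := ∀ n, ω (rayEdge ρ n) = true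

/-- An infinite self-avoiding (undirected) path with endpoint `x`. -/
structure IPath (m : ℕ) (x : V m) where
  vtx : ℕ → V m
  start : vtx 0 = x
  inj : Function.Injective vtx
  adj : ∀ n, ∃ e : Edge m, EndsAt e (vtx n) (vtx (n + 1))

/-- The edges traversed by an infinite path. -/
def IPath.edges {x : V m} (π : IPath m x) : Set (Edge m) :=
  {e | ∃ n, EndsAt e (π.vtx n) (π.vtx (n + 1))}

/-- A path is forward (an `x`-ray) if it is directed away from the root. -/
def IPath.Forward {x : V m} (π : IPath m x) : Prop :=
  ∀ n, ∃ e : Edge m, parentV e = π.vtx n ∧ childV e = π.vtx (n + 1)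

/-- All edges of the path `π` are open in `ω`. -/
def OpenPath {x : V m} (ω : Config m) (π : IPath m x) : Prop :=
  ∀ e ∈ π.edges, ω e = true

/-- The path `π` and the `0`-ray `ρ` differ in only finitely many edges:
`ρ` is the `0`-ray associated with `π`. -/
def Assoc {x : V m} (π : IPath m x) (ρ : Ray m) : Prop :=
  ((IPath.edges π \ rayEdges ρ) ∪ (rayEdges ρ \ IPath.edges π)).Finite

/-- The set of edges with both endvertices in `Λ`. -/
def ELam (Λ : Set (V m)) : Set (Edge m) :=
  {e | parentV e ∈ Λ ∧ childV e ∈ Λ}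

/-- The event `K^S_{u,v,Λ}`: there exist vertex-disjoint open infinite paths from `u` and
from `v`, edge-disjoint from `E_Λ`, whose associated `0`-rays are `S`-related. -/
def KEvent (S : Ray m → Ray m → Prop) (Λ : Set (V m)) (u v : V m) : Set (Config m) :=
  {ω | ∃ (πu : IPath m u) (πv : IPath m v),
      (∀ a b, πu.vtx a ≠ πv.vtx b) ∧
      OpenPath ω πu ∧ OpenPath ω πv ∧
      (∀ e ∈ πu.edges, e ∉ ELam Λ) ∧ (∀ e ∈ πv.edges, e ∉ ELam Λ) ∧
      ∃ ρu ρv : Ray m, Assoc πu ρu ∧ Assoc πv ρv ∧ S ρu ρv}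

/-- The event `A^S_{u,v}`: there exist open `u`- and `v`-rays whose associated
`0`-rays are `S`-related. -/
def AEvent (S : Ray m → Ray m → Prop) (u v : V m) : Set (Config m) :=
  {ω | ∃ (πu : IPath m u) (πv : IPath m v),
      πu.Forward ∧ πv.Forward ∧ OpenPath ω πu ∧ OpenPath ω πv ∧
      ∃ ρu ρv : Ray m, Assoc πu ρu ∧ Assoc πv ρv ∧ S ρu ρv}

/-- The event `A'^S_{u,v}`: there exist open `0`-rays through `u` and through `v`
that are `S`-related. -/
def APrimeEvent (S : Ray m → Ray m → Prop) (u v : V m) : Set (Config m) :=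
  {ω | ∃ ρu ρv : Ray m, RayThrough ρu u ∧ RayThrough ρv v ∧
      OpenRay ω ρu ∧ OpenRay ω ρv ∧ S ρu ρv}

/-- `u` lies on the (unique) path of the tree from the root to `v` (ancestor-or-equal). -/
def Anc : V m → V m → Prop
  | none, _ => True
  | some _, none => False
  | some e, some f => e.1 = f.1 ∧ e.2 <+: f.2

/-- Two vertices are comparable if one lies on the path from the root to the other. -/
def Comparable (u v : V m) : Prop := Anc u v ∨ Anc v u

/-- `W` is a cutset: it is incomparable (no ray contains more than one member of `W`)
and every ray contains some member of `W`. -/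
def IsCutset (W : Set (V m)) : Prop :=
  (∀ (ρ : Ray m) (u v : V m), u ∈ W → v ∈ W → RayThrough ρ u → RayThrough ρ v → u = v) ∧
  ∀ ρ : Ray m, ∃ v ∈ W, RayThrough ρ v

noncomputable section
open scoped ENNReal
open Classical MeasureTheory

variable {m : ℕ}

/-- The finite set of edges with both endvertices in the finite vertex set `Λ`. -/
def EdgeFinset (Λ : Finset (V m)) : Finset (Edge m) :=
  (Λ.preimage (childV) (Option.some_injective _).injOn).filter fun e => parentV e ∈ Λ

/-- The set `Ω^ξ_Λ` of configurations agreeing with `ξ` off `E_Λ`. -/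
def cylinderSet (Λ : Finset (V m)) (ξ : Config m) : Set (Config m) :=
  {ω | ∀ e, e ∉ ELam (↑Λ : Set (V m)) → ω e = ξ e}

/-- `u` and `v` are joined by an `ω`-open path using no edge of `E_Λ`. -/
def OutConn (Λ : Set (V m)) (ω : Config m) (u v : V m) : Prop :=
  ∃ (n : ℕ) (f : ℕ → V m), f 0 = u ∧ f n = v ∧
    ∀ i < n, ∃ e : Edge m, ω e = true ∧ e ∉ ELam Λ ∧ EndsAt e (f i) (f (i + 1))

/-- The adjacency used to count clusters: open edges of `E_Λ` together with the
augmentation rules (a) and (b). -/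
def augRel (S : Ray m → Ray m → Prop) (Λ : Finset (V m)) (ω : Config m) (u v : V m) : Prop :=
  (∃ e ∈ ELam (↑Λ : Set (V m)), ω e = true ∧ EndsAt e u v) ∨
    OutConn (↑Λ : Set (V m)) ω u v ∨ ω ∈ KEvent S (↑Λ : Set (V m)) u v

/-- The number `k^{ξ,∼}(Λ,ω)` of connected components of the augmented open graph on `Λ`
(for `ω` agreeing with `ξ` off `E_Λ`, the boundary condition is read off from `ω` itself). -/
def kCount (S : Ray m → Ray m → Prop) (Λ : Finset (V m)) (ω : Config m) : ℕ :=
  Nat.card (SimpleGraph.fromRel fun u v : {x // x ∈ Λ} => augRel S Λ ω ↑u ↑v).ConnectedComponent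

/-- The random-cluster weight of a configuration. -/
def rcWeight (S : Ray m → Ray m → Prop) (p q : ℝ) (Λ : Finset (V m)) (ω : Config m) : ℝ≥0∞ :=
  (∏ e ∈ EdgeFinset Λ, ENNReal.ofReal (if ω e then p else 1 - p)) *
    ENNReal.ofReal q ^ kCount S Λ ω

/-- The unnormalised random-cluster measure on `Λ` with boundary condition `ξ`. -/
def rcUnnorm (S : Ray m → Ray m → Prop) (p q : ℝ) (Λ : Finset (V m)) (ξ : Config m) :
    Measure (Config m) :=
  Measure.sum fun ω : {ω : Config m // ω ∈ cylinderSet Λ ξ} =>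
    rcWeight S p q Λ (ω : Config m) • Measure.dirac (ω : Config m)

/-- The finite-volume random-cluster measure `φ^{ξ,∼}_{Λ,p,q}`. -/
def rcFin (S : Ray m → Ray m → Prop) (p q : ℝ) (Λ : Finset (V m)) (ξ : Config m) :
    Measure (Config m) :=
  (rcUnnorm S p q Λ ξ Set.univ)⁻¹ • rcUnnorm S p q Λ ξ

/-- The σ-field `T_Λ` generated by the states of edges not in `E_Λ`. -/
def outSigma (Λ : Finset (V m)) : MeasurableSpace (Config m) :=
  MeasurableSpace.comap (fun ω (e : {e : Edge m // e ∉ EdgeFinset Λ}) => ω ↑e) inferInstance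

/-- The set `R^∼_{p,q}` of `(∼)`random-cluster measures: probability measures whose
conditional measure given `T_Λ` at `ξ` is `φ^{ξ,∼}_{Λ,p,q}`, for every finite `Λ`. -/
def RCSet (S : Ray m → Ray m → Prop) (p q : ℝ) : Set (Measure (Config m)) :=
  {φ | IsProbabilityMeasure φ ∧
    ∀ (Λ : Finset (V m)) (A : Set (Config m)), MeasurableSet A →
      ∀ B : Set (Config m), MeasurableSet[outSigma Λ] B →
        φ (A ∩ B) = ∫⁻ ξ in B, rcFin S p q Λ ξ A ∂φ}

/-- Weak convergence of the finite-volume measures as `Λ ↑ V`. -/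
def WeakLim (μs : Finset (V m) → Measure (Config m)) (φ : Measure (Config m)) : Prop :=
  ∀ f : BoundedContinuousFunction (Config m) ℝ,
    Filter.Tendsto (fun Λ => ∫ ω, f ω ∂(μs Λ)) Filter.atTop (nhds (∫ ω, f ω ∂φ))

/-- `μ` is the Bernoulli product measure with density `r` on the edges. -/
def IsBernoulliProduct (r : ℝ) (μ : Measure (Config m)) : Prop :=
  IsProbabilityMeasure μ ∧
    ∀ (s : Finset (Edge m)) (σ : Config m),
      μ {ω | ∀ e ∈ s, ω e = σ e} = ∏ e ∈ s, ENNReal.ofReal (if σ e then r else 1 - r)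

/-- An increasing event. -/
def IncreasingEvent (A : Set (Config m)) : Prop :=
  ∀ ω ω' : Config m, (∀ e, ω e = true → ω' e = true) → ω ∈ A → ω' ∈ A

/-- Stochastic ordering of measures on the configuration space. -/
def StochLE (μ ν : Measure (Config m)) : Prop :=
  ∀ A : Set (Config m), MeasurableSet A → IncreasingEvent A → μ A ≤ ν A

/-- The wired equivalence relation: all rays are equivalent. -/
def wiredRel (m : ℕ) : Ray m → Ray m → Prop := fun _ _ => True

/-- The all-open boundary configuration. -/
def oneCfg (m : ℕ) : Config m := fun _ => true

/-- `S`, viewed as a subset of `R × R`, is closed. -/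
def IsClosedRel (S : Ray m → Ray m → Prop) : Prop :=
  IsClosed {x : Ray m × Ray m | S x.1 x.2}

/-- The closure of the relation `S`: the intersection of all closed equivalence
relations containing `S`. -/
def closureRel (S : Ray m → Ray m → Prop) : Ray m → Ray m → Prop := fun a b =>
  ∀ T : Ray m → Ray m → Prop, Equivalence T → IsClosedRel T → (∀ x y, S x y → T x y) → T a b

end

open MeasureTheory Filter
open scoped ENNReal

variable {m : ℕ}

/-- The σ-field `T_e` generated by the states of the edges other than `e`. -/
noncomputable def outSigmaE (e : Edge m) : MeasurableSpace (Config m) :=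
  MeasurableSpace.comap (fun ω (f : {f : Edge m // f ≠ e}) => ω ↑f) inferInstance

/-- The event `J_e` that the edge `e` is open. -/
def JEdge (e : Edge m) : Set (Config m) := {ω | ω e = true}

/-- The event `K^∼_e` for an edge `e = ⟨u,v⟩`: there exist vertex-disjoint open infinite
paths from the two endvertices of `e`, edge-disjoint from `{e}`, whose associated `0`-rays
are `∼`-equivalent. -/
def KEdge (S : Ray m → Ray m → Prop) (e : Edge m) : Set (Config m) :=
  KEvent S {parentV e, childV e} (parentV e) (childV e)

section

/-! ### Open connections in the tree -/

/-- One step along an open edge. -/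
def Step (ω : Config m) (x y : V m) : Prop := ∃ e : Edge m, ω e = true ∧ EndsAt e x y

/-- Connection by open edges. -/
def Conn (ω : Config m) : V m → V m → Prop := Relation.ReflTransGen (Step ω)

lemma EndsAt.symm {e : Edge m} {x y : V m} (h : EndsAt e x y) : EndsAt e y x := Or.symm h

lemma Step.symm {ω : Config m} {x y : V m} (h : Step ω x y) : Step ω y x :=
  let ⟨e, he, h⟩ := h
  ⟨e, he, h.symm⟩

lemma Conn.symm {ω : Config m} {x y : V m} (h : Conn ω x y) : Conn ω y x := by
  induction h with
  | refl => exact .refl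
  | tail _ h ih => exact .head h.symm ih

lemma Conn.mono {ω ω' : Config m} (h : ∀ e, ω e = true → ω' e = true) {x y : V m}
    (hxy : Conn ω x y) : Conn ω' x y :=
  Relation.ReflTransGen.mono (r := Step ω) (p := Step ω')
    (fun _ _ ⟨e, he, h'⟩ => ⟨e, h e he, h'⟩) _ _ hxy

lemma parentV_append (a : Fin (m + 1)) (l : List (Fin m)) (b : Fin m) :
    parentV ((a, l ++ [b]) : Edge m) = some (a, l) := by
  simp [parentV]

/-- The depth of a vertex. -/
def depth : V m → ℕ
  | none => 0
  | some e => e.2.length + 1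

lemma depth_childV (e : Edge m) : depth (childV e) = depth (parentV e) + 1 := by
  obtain ⟨a, l⟩ := e
  rcases List.eq_nil_or_concat l with rfl | ⟨l, b, rfl⟩
  · simp [childV, parentV, depth]
  · simp only [List.concat_eq_append]
    rw [parentV_append]
    simp [childV, depth]

lemma parentV_ne_childV (e : Edge m) : parentV e ≠ childV e := fun h => by
  have := depth_childV e
  rw [← h] at this
  omega

lemma EndsAt.ne {e : Edge m} {x y : V m} (h : EndsAt e x y) : x ≠ y := by
  rcases h with ⟨rfl, rfl⟩ | ⟨rfl, rfl⟩
  · exact parentV_ne_childV e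
  · exact (parentV_ne_childV e).symm

lemma EndsAt.unique {e f : Edge m} {x y : V m} (he : EndsAt e x y) (hf : EndsAt f x y) :
    e = f := by
  have he' := depth_childV e
  have hf' := depth_childV f
  rcases he with ⟨h1, h2⟩ | ⟨h1, h2⟩ <;> rcases hf with ⟨h3, h4⟩ | ⟨h3, h4⟩
  · exact Option.some_injective _ (h2.trans h4.symm)
  · rw [h1, h2] at he'; rw [h3, h4] at hf'; omega
  · rw [h1, h2] at he'; rw [h3, h4] at hf'; omega
  · exact Option.some_injective _ (h2.trans h4.symm)

lemma EndsAt.cases {e : Edge m} {x y x' y' : V m} (h : EndsAt e x y) (h' : EndsAt e x' y') :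
    (x = x' ∧ y = y') ∨ (x = y' ∧ y = x') := by
  rcases h with ⟨rfl, rfl⟩ | ⟨rfl, rfl⟩ <;> rcases h' with ⟨rfl, rfl⟩ | ⟨rfl, rfl⟩ <;> simp

lemma endsAt_self (e : Edge m) : EndsAt e (parentV e) (childV e) := Or.inl ⟨rfl, rfl⟩

lemma conn_none (x : V m) : Conn (oneCfg m) none x := by
  match x with
  | none => exact .refl
  | some (a, l) =>
    induction l using List.reverseRecOn with
    | nil => exact .single ⟨(a, []), rfl, Or.inl ⟨by simp [parentV], rfl⟩⟩
    | append_singleton l b ih =>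
      exact .tail ih ⟨(a, l ++ [b]), rfl, Or.inl ⟨parentV_append a l b, rfl⟩⟩

lemma conn_one (x y : V m) : Conn (oneCfg m) x y := (conn_none x).symm.trans (conn_none y)

/-- Endpoints of an edge other than `e` lie on the same side of `e`. -/
lemma anc_parentV_iff {e f : Edge m} (h : f ≠ e) :
    Anc (childV e) (parentV f) ↔ Anc (childV e) (childV f) := by
  obtain ⟨a, l⟩ := e
  obtain ⟨b, l'⟩ := f
  rcases List.eq_nil_or_concat l' with rfl | ⟨l', c, rfl⟩
  · have : parentV ((b, []) : Edge m) = none := by simp [parentV]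
    rw [this]
    simp only [childV, Anc, List.prefix_nil, false_iff, not_and]
    rintro rfl rfl
    exact h rfl
  · simp only [List.concat_eq_append] at h ⊢
    rw [parentV_append]
    simp only [childV, Anc, List.prefix_concat_iff]
    constructor
    · rintro ⟨h1, h2⟩
      exact ⟨h1, Or.inr h2⟩
    · rintro ⟨rfl, rfl | h2⟩
      · exact absurd rfl h
      · exact ⟨rfl, h2⟩

lemma Conn.anc_iff {ω : Config m} {e : Edge m} (he : ω e = false) {x y : V m}
    (h : Conn ω x y) : Anc (childV e) x ↔ Anc (childV e) y := by
  induction h with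
  | refl => rfl
  | tail _ h ih =>
    obtain ⟨f, hf, hxy⟩ := h
    have hne : f ≠ e := by rintro rfl; simp [he] at hf
    rw [ih]
    rcases hxy with ⟨rfl, rfl⟩ | ⟨rfl, rfl⟩
    · exact anc_parentV_iff hne
    · exact (anc_parentV_iff hne).symm

lemma not_conn_of_closed {ω : Config m} {e : Edge m} (he : ω e = false) {x y : V m}
    (hxy : EndsAt e x y) : ¬ Conn ω x y := by
  have key : ¬ Conn ω (parentV e) (childV e) := fun h => by
    have h1 := (h.anc_iff he).2 (by simp [childV, Anc])
    have h2 := depth_childV e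
    obtain ⟨a, l⟩ := e
    rcases List.eq_nil_or_concat l with rfl | ⟨l, b, rfl⟩
    · simp [childV, parentV, Anc] at h1
    · simp only [List.concat_eq_append] at h1
      rw [parentV_append] at h1
      simpa using h1.2.length_le
  rcases hxy with ⟨rfl, rfl⟩ | ⟨rfl, rfl⟩
  · exact key
  · exact fun h => key h.symm

/-! ### Rays reached by open paths -/

lemma rayEdge_injective (ρ : Ray m) : Function.Injective (rayEdge ρ) := fun a b h => by
  simpa [rayEdge] using congrArg (fun e : Edge m => e.2.length) h

lemma depth_rayVtx (ρ : Ray m) (n : ℕ) : depth (rayVtx ρ n) = n := by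
  cases n <;> simp [rayVtx, depth, rayEdge]

lemma rayVtx_injective (ρ : Ray m) : Function.Injective (rayVtx ρ) := fun a b h => by
  simpa [depth_rayVtx] using congrArg depth h

lemma childV_rayEdge (ρ : Ray m) (n : ℕ) : childV (rayEdge ρ n) = rayVtx ρ (n + 1) := rfl

lemma parentV_rayEdge (ρ : Ray m) (n : ℕ) : parentV (rayEdge ρ n) = rayVtx ρ n := by
  cases n with
  | zero => simp [rayEdge, parentV, rayVtx]
  | succ n =>
    have : rayEdge ρ (n + 1) = (ρ.1, (List.ofFn fun k : Fin n => ρ.2 k) ++ [ρ.2 n]) := by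
      simp only [rayEdge, Prod.mk.injEq, true_and]
      rw [List.ofFn_succ_last]
      simp
    rw [this, parentV_append]
    rfl

lemma endsAt_rayEdge (ρ : Ray m) (n : ℕ) : EndsAt (rayEdge ρ n) (rayVtx ρ n) (rayVtx ρ (n + 1)) :=
  Or.inl ⟨parentV_rayEdge ρ n, childV_rayEdge ρ n⟩

/-- The tail of `ρ` is open and joined to `x` by open edges. -/
def Lim (ω : Config m) (x : V m) (ρ : Ray m) : Prop :=
  ∃ N, (∀ n ≥ N, ω (rayEdge ρ n) = true) ∧ Conn ω x (rayVtx ρ N)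

lemma conn_rayVtx {ω : Config m} {ρ : Ray m} {N : ℕ} (h : ∀ n ≥ N, ω (rayEdge ρ n) = true)
    {n : ℕ} (hn : N ≤ n) : Conn ω (rayVtx ρ N) (rayVtx ρ n) := by
  induction n, hn using Nat.le_induction with
  | base => exact .refl
  | succ n hn ih => exact .tail ih ⟨_, h n hn, endsAt_rayEdge ρ n⟩

lemma Lim.eventually {ω : Config m} {x : V m} {ρ : Ray m} (h : Lim ω x ρ) :
    ∃ N, ∀ n ≥ N, ω (rayEdge ρ n) = true ∧ Conn ω x (rayVtx ρ n) := by
  obtain ⟨N, h1, h2⟩ := h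
  exact ⟨N, fun n hn => ⟨h1 n hn, h2.trans (conn_rayVtx h1 hn)⟩⟩

lemma Lim.mono {ω ω' : Config m} (h : ∀ e, ω e = true → ω' e = true) {x : V m} {ρ : Ray m}
    (hx : Lim ω x ρ) : Lim ω' x ρ :=
  let ⟨N, h1, h2⟩ := hx
  ⟨N, fun n hn => h _ (h1 n hn), h2.mono h⟩

lemma Lim.of_conn {ω : Config m} {x y : V m} {ρ : Ray m} (h : Lim ω x ρ) (hxy : Conn ω y x) :
    Lim ω y ρ :=
  let ⟨N, h1, h2⟩ := h
  ⟨N, h1, hxy.trans h2⟩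

lemma IPath.conn_vtx {ω : Config m} {x : V m} (π : IPath m x) (h : OpenPath ω π) (n : ℕ) :
    Conn ω x (π.vtx n) := by
  induction n with
  | zero => rw [π.start]; exact .refl
  | succ n ih =>
    obtain ⟨e, he⟩ := π.adj n
    exact .tail ih ⟨e, h e ⟨n, he⟩, he⟩

lemma lim_of_path {ω : Config m} {x : V m} (π : IPath m x) (h : OpenPath ω π) {ρ : Ray m}
    (hρ : Assoc π ρ) : Lim ω x ρ := by
  have hfin : {n | rayEdge ρ n ∉ π.edges}.Finite := by
    refine Set.Finite.of_finite_image (f := rayEdge ρ) (hρ.subset ?_)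
      (rayEdge_injective ρ).injOn
    rintro _ ⟨n, hn, rfl⟩
    exact Or.inr ⟨⟨n, rfl⟩, hn⟩
  obtain ⟨N, hN⟩ := hfin.bddAbove
  have hmem : ∀ n ≥ N + 1, rayEdge ρ n ∈ π.edges := fun n hn => by
    by_contra hc
    have := hN hc
    omega
  refine ⟨N + 1, fun n hn => h _ (hmem n hn), ?_⟩
  obtain ⟨k, hk⟩ := hmem (N + 1) le_rfl
  rcases hk.cases (endsAt_rayEdge ρ (N + 1)) with ⟨h1, -⟩ | ⟨-, h1⟩
  · rw [← h1]; exact π.conn_vtx h k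
  · rw [← h1]; exact π.conn_vtx h (k + 1)

lemma Conn.exists_fun {ω : Config m} {x y : V m} (h : Conn ω x y) :
    ∃ (n : ℕ) (f : ℕ → V m), f 0 = x ∧ f n = y ∧ ∀ i < n, Step ω (f i) (f (i + 1)) := by
  induction h using Relation.ReflTransGen.head_induction_on with
  | refl => exact ⟨0, fun _ => y, rfl, rfl, by simp⟩
  | @head a c h _ ih =>
    obtain ⟨n, f, h0, hn, hs⟩ := ih
    refine ⟨n + 1, fun i => Nat.casesOn (motive := fun _ => V m) i a f, rfl, hn, ?_⟩
    rintro (_ | i) hi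
    · simpa [h0] using h
    · exact hs i (by omega)

lemma conn_of_fun {ω : Config m} {n : ℕ} {f : ℕ → V m}
    (hs : ∀ i < n, Step ω (f i) (f (i + 1))) : ∀ i ≤ n, Conn ω (f 0) (f i) := by
  intro i hi
  induction i with
  | zero => exact .refl
  | succ i ih => exact .tail (ih (by omega)) (hs i (by omega))

/-- Along a shortest walk into a set of targets, vertices are distinct and only the last one
is a target. -/
lemma exists_path_of_lim {ω : Config m} {x : V m} {ρ : Ray m} (h : Lim ω x ρ) :
    ∃ π : IPath m x, OpenPath ω π ∧ Assoc π ρ := by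
  classical
  obtain ⟨N, h1, h2⟩ := h
  have hex : ∃ n : ℕ, ∃ f : ℕ → V m, f 0 = x ∧ (∃ k ≥ N, f n = rayVtx ρ k) ∧
      ∀ i < n, Step ω (f i) (f (i + 1)) := by
    obtain ⟨n, f, h0, hn, hs⟩ := h2.exists_fun
    exact ⟨n, f, h0, ⟨N, le_rfl, hn⟩, hs⟩
  obtain ⟨f, h0, ⟨k, hk, hn⟩, hs⟩ := Nat.find_spec hex
  have hmin : ∀ n' < Nat.find hex, ¬ _ := fun n' hn' => Nat.find_min hex hn'
  generalize Nat.find hex = L at *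
  have hnt : ∀ i < L, ∀ j ≥ N, f i ≠ rayVtx ρ j := fun i hi j hj hij =>
    hmin i hi ⟨f, h0, ⟨j, hj, hij⟩, fun a ha => hs a (by omega)⟩
  have hinj : ∀ i j, i < j → j ≤ L → f i ≠ f j := fun i j hij hj heq => by
    refine hmin (L - (j - i)) (by omega) ⟨fun a => if a ≤ i then f a else f (a + (j - i)), ?_,
      ⟨k, hk, ?_⟩, ?_⟩
    · simp [h0]
    · rcases eq_or_lt_of_le hj with rfl | hj'
      · simp only [show j - (j - i) ≤ i by omega, if_true]
        rw [show j - (j - i) = i by omega, heq, hn]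
      · simp only [show ¬ L - (j - i) ≤ i by omega, if_false]
        rw [show L - (j - i) + (j - i) = L by omega, hn]
    · intro a ha
      rcases lt_trichotomy a i with hai | rfl | hai
      · simp only [hai.le, if_true, show a + 1 ≤ i by omega]
        exact hs a (by omega)
      · simp only [le_refl, if_true, show ¬ a + 1 ≤ a by omega, if_false]
        rw [heq, show a + 1 + (j - a) = j + 1 by omega]
        exact hs j (by omega)
      · simp only [show ¬ a ≤ i by omega, if_false, show ¬ a + 1 ≤ i by omega]
        rw [show a + 1 + (j - i) = a + (j - i) + 1 by omega]
        exact hs _ (by omega)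
  let g : ℕ → V m := fun a => if a ≤ L then f a else rayVtx ρ (k + (a - L))
  have hg1 : ∀ a ≤ L, g a = f a := fun a ha => by simp [g, ha]
  have hg2 : ∀ a, g (L + a) = rayVtx ρ (k + a) := fun a => by
    rcases Nat.eq_zero_or_pos a with rfl | ha
    · simp [g, hn]
    · simp [g, show ¬ L + a ≤ L by omega]
  have hstep : ∀ a, (a < L ∧ Step ω (g a) (g (a + 1))) ∨
      (L ≤ a ∧ EndsAt (rayEdge ρ (k + (a - L))) (g a) (g (a + 1))) := fun a => by
    rcases lt_or_ge a L with ha | ha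
    · left
      rw [hg1 a ha.le, hg1 (a + 1) ha]
      exact ⟨ha, hs a ha⟩
    · right
      obtain ⟨b, rfl⟩ := Nat.exists_eq_add_of_le ha
      rw [hg2, add_assoc, hg2]
      simpa [add_assoc] using endsAt_rayEdge ρ (k + b)
  have hginj : ∀ a b, a < b → g a ≠ g b := fun a b hab => by
    rcases le_or_gt b L with hb | hb
    · rw [hg1 a (by omega), hg1 b hb]; exact hinj a b hab hb
    · obtain ⟨c, rfl⟩ := Nat.exists_eq_add_of_le hb.le
      rw [hg2]
      rcases lt_or_ge a L with ha | ha
      · rw [hg1 a ha.le]; exact hnt a ha _ (by omega)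
      · obtain ⟨d, rfl⟩ := Nat.exists_eq_add_of_le ha
        rw [hg2]
        exact fun h => by have := rayVtx_injective ρ h; omega
  let π : IPath m x :=
    { vtx := g
      start := by rw [hg1 0 (Nat.zero_le _), h0]
      inj := fun a b hab => by
        rcases lt_trichotomy a b with h | h | h
        · exact absurd hab (hginj a b h)
        · exact h
        · exact absurd hab.symm (hginj b a h)
      adj := fun a => by
        rcases hstep a with ⟨-, e, -, he⟩ | ⟨-, he⟩
        · exact ⟨e, he⟩
        · exact ⟨_, he⟩ }
  refine ⟨π, ?_, ?_⟩
  · rintro e ⟨a, ha⟩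
    rcases hstep a with ⟨-, e', he', h'⟩ | ⟨-, h'⟩
    · rwa [ha.unique h']
    · rw [EndsAt.unique ha h']
      exact h1 _ (by omega)
  · have hf1 : {e : Edge m | ∃ a < L, EndsAt e (g a) (g (a + 1))}.Finite := by
      have : {e : Edge m | ∃ a < L, EndsAt e (g a) (g (a + 1))} =
          ⋃ a ∈ Set.Iio L, {e : Edge m | EndsAt e (g a) (g (a + 1))} := by
        ext e; simp
      rw [this]
      exact (Set.finite_Iio L).biUnion fun a _ =>
        Set.Subsingleton.finite fun _ h _ h' => EndsAt.unique h h'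
    refine (hf1.union ((Set.finite_Iio k).image (rayEdge ρ))).subset ?_
    rintro e (⟨⟨a, ha⟩, he⟩ | ⟨⟨b, rfl⟩, he⟩)
    · left
      rcases hstep a with ⟨haL, -⟩ | ⟨-, h'⟩
      · exact ⟨a, haL, ha⟩
      · exact absurd ⟨_, (EndsAt.unique ha h').symm⟩ he
    · right
      refine ⟨b, ?_, rfl⟩
      by_contra hb
      simp only [Set.mem_Iio, not_lt] at hb
      obtain ⟨c, rfl⟩ := Nat.exists_eq_add_of_le hb
      refine he ⟨L + c, ?_⟩
      change EndsAt _ (g _) (g _)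
      rw [hg2, add_assoc, hg2]
      exact endsAt_rayEdge ρ (k + c)

/-- `x` and `y` reach `S`-related rays. -/
def Rel (S : Ray m → Ray m → Prop) (ω : Config m) (x y : V m) : Prop :=
  ∃ ρ ρ' : Ray m, Lim ω x ρ ∧ Lim ω y ρ' ∧ S ρ ρ'

variable {S : Ray m → Ray m → Prop}

lemma Rel.mono {ω ω' : Config m} (h : ∀ e, ω e = true → ω' e = true) {x y : V m}
    (hx : Rel S ω x y) : Rel S ω' x y :=
  let ⟨ρ, ρ', h1, h2, h3⟩ := hx
  ⟨ρ, ρ', h1.mono h, h2.mono h, h3⟩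

lemma Rel.of_conn {ω : Config m} {x y x' y' : V m} (h : Rel S ω x y) (hx : Conn ω x' x)
    (hy : Conn ω y y') : Rel S ω x' y' :=
  let ⟨ρ, ρ', h1, h2, h3⟩ := h
  ⟨ρ, ρ', h1.of_conn hx, h2.of_conn hy.symm, h3⟩

lemma Rel.symm (hS : Equivalence S) {ω : Config m} {x y : V m} (h : Rel S ω x y) :
    Rel S ω y x :=
  let ⟨ρ, ρ', h1, h2, h3⟩ := h
  ⟨ρ', ρ, h2, h1, hS.symm h3⟩

open Classical in
/-- The configuration with all edges of `E_Λ` closed. -/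
noncomputable def offCfg (Λ : Set (V m)) (ω : Config m) : Config m :=
  fun e => if e ∈ ELam Λ then false else ω e

lemma offCfg_eq_true {Λ : Set (V m)} {ω : Config m} {e : Edge m} :
    offCfg Λ ω e = true ↔ e ∉ ELam Λ ∧ ω e = true := by
  simp only [offCfg]; split_ifs <;> simp_all

lemma outConn_iff {Λ : Set (V m)} {ω : Config m} {u v : V m} :
    OutConn Λ ω u v ↔ Conn (offCfg Λ ω) u v := by
  constructor
  · rintro ⟨n, f, rfl, rfl, h⟩
    refine conn_of_fun (fun i hi => ?_) n le_rfl
    obtain ⟨e, h1, h2, h3⟩ := h i hi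
    exact ⟨e, offCfg_eq_true.2 ⟨h2, h1⟩, h3⟩
  · intro h
    obtain ⟨n, f, h0, hn, hs⟩ := h.exists_fun
    refine ⟨n, f, h0, hn, fun i hi => ?_⟩
    obtain ⟨e, h1, h2⟩ := hs i hi
    obtain ⟨h3, h4⟩ := offCfg_eq_true.1 h1
    exact ⟨e, h4, h3, h2⟩

lemma rel_of_mem_kEvent {Λ : Set (V m)} {ω : Config m} {u v : V m} (h : ω ∈ KEvent S Λ u v) :
    Rel S (offCfg Λ ω) u v := by
  obtain ⟨πu, πv, -, hu, hv, hu', hv', ρ, ρ', h1, h2, h3⟩ := h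
  exact ⟨ρ, ρ', lim_of_path πu (fun e he => offCfg_eq_true.2 ⟨hu' e he, hu e he⟩) h1,
    lim_of_path πv (fun e he => offCfg_eq_true.2 ⟨hv' e he, hv e he⟩) h2, h3⟩

lemma mem_kEvent_of_rel {Λ : Set (V m)} {ω : Config m} {u v : V m}
    (h : Rel S (offCfg Λ ω) u v) (hn : ¬ Conn (offCfg Λ ω) u v) : ω ∈ KEvent S Λ u v := by
  obtain ⟨ρ, ρ', h1, h2, h3⟩ := h
  obtain ⟨πu, hu, hu'⟩ := exists_path_of_lim h1
  obtain ⟨πv, hv, hv'⟩ := exists_path_of_lim h2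
  refine ⟨πu, πv, fun a b hab => hn ?_, fun e he => (offCfg_eq_true.1 (hu e he)).2,
    fun e he => (offCfg_eq_true.1 (hv e he)).2, fun e he => (offCfg_eq_true.1 (hu e he)).1,
    fun e he => (offCfg_eq_true.1 (hv e he)).1, ρ, ρ', hu', hv', h3⟩
  have := πu.conn_vtx hu a
  rw [hab] at this
  exact this.trans (πv.conn_vtx hv b).symm

lemma augRel_iff {Λ : Finset (V m)} {ω : Config m} {u v : V m} :
    augRel S Λ ω u v ↔ (∃ e ∈ ELam (↑Λ : Set (V m)), ω e = true ∧ EndsAt e u v) ∨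
      Conn (offCfg ↑Λ ω) u v ∨ Rel S (offCfg ↑Λ ω) u v := by
  unfold augRel
  rw [outConn_iff]
  constructor
  · rintro (h | h | h)
    exacts [Or.inl h, Or.inr (Or.inl h), Or.inr (Or.inr (rel_of_mem_kEvent h))]
  · rintro (h | h | h)
    · exact Or.inl h
    · exact Or.inr (Or.inl h)
    · by_cases hc : Conn (offCfg ↑Λ ω) u v
      · exact Or.inr (Or.inl hc)
      · exact Or.inr (Or.inr (mem_kEvent_of_rel h hc))

lemma eLam_pair (e : Edge m) : ELam {parentV e, childV e} = {e} := by
  ext f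
  simp only [ELam, Set.mem_ofPred_eq, Set.mem_insert_iff, Set.mem_singleton_iff]
  constructor
  · rintro ⟨h1, h2⟩
    have := depth_childV e
    have := depth_childV f
    rcases h2 with h2 | h2
    · rcases h1 with h1 | h1
      · exact absurd (h1.trans h2.symm) (parentV_ne_childV f)
      · rw [h1, h2] at this; omega
    · exact Option.some_injective _ h2
  · rintro rfl
    simp

/-- Opening an edge. -/
noncomputable def openE (e : Edge m) (ω : Config m) : Config m := Function.update ω e true

/-- Closing an edge. -/
noncomputable def closeE (e : Edge m) (ω : Config m) : Config m := Function.update ω e false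

lemma offCfg_pair (e : Edge m) (ω : Config m) : offCfg {parentV e, childV e} ω = closeE e ω := by
  ext f
  simp [offCfg, eLam_pair, closeE, Function.update_apply]

lemma mem_kEdge_iff {e : Edge m} {ω : Config m} :
    ω ∈ KEdge S e ↔ Rel S (closeE e ω) (parentV e) (childV e) := by
  rw [← offCfg_pair]
  refine ⟨rel_of_mem_kEvent, fun h => mem_kEvent_of_rel h ?_⟩
  rw [offCfg_pair]
  exact not_conn_of_closed (by simp [closeE]) (endsAt_self e)

/-! ### Consistency of single-edge conditional probabilities -/

/-- The edge `e` has `w` as an endvertex. -/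
def Incident (e : Edge m) (w : V m) : Prop := parentV e = w ∨ childV e = w

lemma finite_incident (w : V m) : {e : Edge m | Incident e w}.Finite := by
  have h1 : {e : Edge m | childV e = w}.Finite :=
    Set.Subsingleton.finite fun e he f hf => Option.some_injective _ (he.trans hf.symm)
  have h2 : {e : Edge m | parentV e = w}.Finite := by
    refine ((Set.finite_range fun a : Fin (m + 1) => ((a, []) : Edge m)).union
      (Set.finite_range fun b : Fin m =>
        ((w.elim (0, []) id).1, (w.elim (0, []) id).2 ++ [b]))).subset ?_
    rintro ⟨a, l⟩ he
    rcases List.eq_nil_or_concat l with rfl | ⟨l, b, rfl⟩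
    · exact Or.inl ⟨a, rfl⟩
    · simp only [List.concat_eq_append, Set.mem_ofPred_eq] at he ⊢
      rw [parentV_append] at he
      subst he
      exact Or.inr ⟨b, rfl⟩
  exact (h2.union h1).subset fun e he => he

lemma EndsAt.incident_left {e : Edge m} {x y : V m} (h : EndsAt e x y) : Incident e x :=
  h.imp (·.1) (·.2)

lemma EndsAt.incident_right {e : Edge m} {x y : V m} (h : EndsAt e x y) : Incident e y :=
  h.symm.incident_left

lemma EndsAt.eq_or_eq {e : Edge m} {x y w : V m} (h : EndsAt e x y) (hw : Incident e w) :
    w = x ∨ w = y := by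
  rcases h with ⟨rfl, rfl⟩ | ⟨rfl, rfl⟩ <;> rcases hw with rfl | rfl <;> simp

open Classical in
/-- Open the edge `f` and close all other edges at the vertex `w`. -/
noncomputable def pendant (f : Edge m) (w : V m) (ω : Config m) : Config m :=
  fun e => if e = f then true else if Incident e w then false else ω e

lemma pendant_of_not_incident {f e : Edge m} {w : V m} {ω : Config m} (h : ¬ Incident e w)
    (he : ω e = true) : pendant f w ω e = true := by
  simp only [pendant]
  split_ifs <;> simp_all

lemma of_pendant {f e : Edge m} {w : V m} {ω : Config m} (he : pendant f w ω e = true)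
    (hef : e ≠ f) : ¬ Incident e w ∧ ω e = true := by
  simp only [pendant, if_neg hef] at he
  split_ifs at he
  exact ⟨‹_›, he⟩

lemma conn_of_conn_pendant {f : Edge m} {a w : V m} (hf : EndsAt f a w) {ω : Config m}
    {u z : V m} (hu : u ≠ w) (h : Conn (pendant f w ω) u z) :
    (z ≠ w ∧ Conn ω u z) ∨ (z = w ∧ Conn ω u a) := by
  induction h with
  | refl => exact Or.inl ⟨hu, .refl⟩
  | tail _ h ih =>
    obtain ⟨e, he, hxy⟩ := h
    by_cases hef : e = f
    · subst hef
      rcases hxy.cases hf with ⟨rfl, rfl⟩ | ⟨rfl, rfl⟩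
      · rcases ih with ih | ih
        · exact Or.inr ⟨rfl, ih.2⟩
        · exact absurd ih.1 hf.ne
      · rcases ih with ih | ih
        · exact absurd rfl ih.1
        · exact Or.inl ⟨hf.ne, ih.2⟩
    · obtain ⟨h1, h2⟩ := of_pendant he hef
      rcases ih with ih | ih
      · refine Or.inl ⟨?_, .tail ih.2 ⟨e, h2, hxy⟩⟩
        rintro rfl
        exact h1 hxy.incident_right
      · rw [ih.1] at hxy
        exact absurd hxy.incident_left h1

lemma lim_of_lim_pendant {f : Edge m} {a w : V m} (hf : EndsAt f a w) {ω : Config m}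
    {u : V m} (hu : u ≠ w) {ρ : Ray m} (h : Lim (pendant f w ω) u ρ) : Lim ω u ρ := by
  obtain ⟨N, hN⟩ := h.eventually
  have hw : ∀ n > depth w, rayVtx ρ n ≠ w := fun n hn heq => by
    rw [← heq, depth_rayVtx] at hn
    omega
  have key : ∀ n ≥ max N (depth w + 1), ω (rayEdge ρ n) = true ∧ Conn ω u (rayVtx ρ n) := by
    intro n hn
    have hn1 : N ≤ n := (le_max_left _ _).trans hn
    have hn2 : depth w + 1 ≤ n := (le_max_right _ _).trans hn
    have hi : ¬ Incident (rayEdge ρ n) w := fun hi => by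
      rcases (endsAt_rayEdge ρ n).eq_or_eq hi with h | h
      · exact hw n (by omega) h.symm
      · exact hw (n + 1) (by omega) h.symm
    refine ⟨(of_pendant (hN n hn1).1 ?_).2, ?_⟩
    · rintro h
      rw [h] at hi
      exact hi hf.incident_right
    · rcases conn_of_conn_pendant hf hu (hN n hn1).2 with h | h
      · exact h.2
      · exact absurd h.1 (hw n (by omega))
  exact ⟨_, fun n hn => (key n hn).1, (key _ le_rfl).2⟩

lemma rel_of_rel_pendant {f : Edge m} {a w : V m} (hf : EndsAt f a w) {ω : Config m}
    {u v : V m} (hu : u ≠ w) (hv : v ≠ w) (h : Rel S (pendant f w ω) u v) : Rel S ω u v :=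
  let ⟨ρ, ρ', h1, h2, h3⟩ := h
  ⟨ρ, ρ', lim_of_lim_pendant hf hu h1, lim_of_lim_pendant hf hv h2, h3⟩

lemma conn_pendant {f : Edge m} {w : V m} {ω : Config m} {u z : V m} (hu : ¬ Conn ω u w)
    (h : Conn ω u z) : Conn (pendant f w ω) u z := by
  induction h with
  | refl => exact .refl
  | tail hb h ih =>
    refine .tail ih ?_
    obtain ⟨e, he, hxy⟩ := h
    refine ⟨e, pendant_of_not_incident (fun hi => ?_) he, hxy⟩
    rcases hxy.eq_or_eq hi with rfl | rfl
    · exact hu hb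
    · exact hu (.tail hb ⟨e, he, hxy⟩)

lemma lim_pendant {f : Edge m} {w : V m} {ω : Config m} {u : V m} (hu : ¬ Conn ω u w)
    {ρ : Ray m} (h : Lim ω u ρ) : Lim (pendant f w ω) u ρ := by
  obtain ⟨N, hN⟩ := h.eventually
  refine ⟨N, fun n hn => pendant_of_not_incident (fun hi => ?_) (hN n hn).1,
    conn_pendant hu (hN N le_rfl).2⟩
  rcases (endsAt_rayEdge ρ n).eq_or_eq hi with h | h
  · exact hu (h ▸ (hN n hn).2)
  · exact hu (h ▸ (hN (n + 1) (by omega)).2)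

lemma rel_pendant {f : Edge m} {w : V m} {ω : Config m} {u v : V m} (hu : ¬ Conn ω u w)
    (hv : ¬ Conn ω v w) (h : Rel S ω u v) : Rel S (pendant f w ω) u v :=
  let ⟨ρ, ρ', h1, h2, h3⟩ := h
  ⟨ρ, ρ', lim_pendant hu h1, lim_pendant hv h2, h3⟩

lemma closeE_of_closed {e : Edge m} {ω : Config m} (he : ω e = false) : closeE e ω = ω := by
  simp [closeE, ← he]

lemma mem_kEdge_of_closed (hS : Equivalence S) {e : Edge m} {ω : Config m} (he : ω e = false)
    {x y : V m} (hxy : EndsAt e x y) : ω ∈ KEdge S e ↔ Rel S ω x y := by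
  rw [mem_kEdge_iff, closeE_of_closed he]
  rcases hxy with ⟨rfl, rfl⟩ | ⟨rfl, rfl⟩
  · rfl
  · exact ⟨fun h => h.symm hS, fun h => h.symm hS⟩

/-- The single-edge conditional probabilities along `e` and `f` commute at `ω`. -/
def SquareConsistent (S : Ray m → Ray m → Prop) (ω : Config m) : Prop :=
  ∀ e f : Edge m, e ≠ f → ω e = false → ω f = false → ω ∈ KEdge S f → openE f ω ∈ KEdge S e →
    ω ∈ KEdge S e

/-- All finite modifications of `ω` are consistent. -/
def Consistent (S : Ray m → Ray m → Prop) (ω : Config m) : Prop :=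
  ∀ ω' : Config m, {e | ω' e ≠ ω e}.Finite → SquareConsistent S ω'

lemma Consistent.modify {ω ω' : Config m} (h : Consistent S ω) (hf : {e | ω' e ≠ ω e}.Finite) :
    Consistent S ω' := fun ω'' h'' => h ω'' <| (h''.union hf).subset fun e he => by
  by_contra hc
  simp only [Set.mem_union, Set.mem_ofPred_eq, not_or, not_not] at hc he
  exact he (hc.1.trans hc.2)

lemma Consistent.pendant {ω : Config m} (h : Consistent S ω) (f : Edge m) (w : V m) :
    Consistent S (pendant f w ω) := by
  refine h.modify (((finite_incident w).union (Set.finite_singleton f)).subset fun e he => ?_)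
  by_contra hc
  simp only [Set.mem_union, Set.mem_ofPred_eq, Set.mem_singleton_iff, not_or] at hc he
  simp [RCTree.pendant, hc] at he

lemma Consistent.openE {ω : Config m} (h : Consistent S ω) (f : Edge m) :
    Consistent S (openE f ω) := by
  refine h.modify ((Set.finite_singleton f).subset fun e he => ?_)
  by_contra hc
  simp only [Set.mem_singleton_iff, Set.mem_ofPred_eq] at hc he
  simp [RCTree.openE, hc] at he

lemma Consistent.closeE {ω : Config m} (h : Consistent S ω) (f : Edge m) :
    Consistent S (closeE f ω) := by
  refine h.modify ((Set.finite_singleton f).subset fun e he => ?_)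
  by_contra hc
  simp only [Set.mem_singleton_iff, Set.mem_ofPred_eq] at hc he
  simp [RCTree.closeE, hc] at he

lemma le_openE {f : Edge m} {ω : Config m} (e : Edge m) (he : ω e = true) :
    openE f ω e = true := by
  simp only [openE, Function.update_apply]
  split_ifs <;> simp_all

lemma SquareConsistent.rel {ω : Config m} (hS : Equivalence S) (h : SquareConsistent S ω)
    {e f : Edge m} (hef : e ≠ f) (he : ω e = false) (hf : ω f = false) {u v a b : V m}
    (hu : EndsAt e u v) (ha : EndsAt f a b) (h1 : Rel S ω a b) (h2 : Rel S (openE f ω) u v) :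
    Rel S ω u v := by
  refine (mem_kEdge_of_closed hS he hu).1 (h e f hef he hf
    ((mem_kEdge_of_closed hS hf ha).2 h1) ((mem_kEdge_of_closed hS ?_ hu).2 h2))
  simp [openE, hef, he]

/-- In a consistent configuration, a chain of related clusters between the endvertices of a
closed edge forces these endvertices to be related. -/
lemma rel_of_chain (hS : Equivalence S) (n : ℕ) (hn : 1 ≤ n) :
    ∀ (ω : Config m), Consistent S ω → ∀ (e : Edge m), ω e = false → ∀ x : ℕ → V m,
      EndsAt e (x 0) (x n) → (∀ i < n, Rel S ω (x i) (x (i + 1))) → Rel S ω (x 0) (x n) := by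
  induction n using Nat.strong_induction_on with
  | _ n ih =>
  intro ω hω e he x hx hrel
  rcases eq_or_lt_of_le hn with rfl | hn2
  · exact hrel 0 one_pos
  have prefixRel : ∀ {ω : Config m}, Consistent S ω → ∀ {e : Edge m}, ω e = false →
      (∀ i < n, Rel S ω (x i) (x (i + 1))) → ∀ {i : ℕ}, 0 < i → i < n → ∀ {y z : V m},
      EndsAt e y z → Conn ω y (x 0) → Conn ω (x i) z → Rel S ω y z := by
    intro ω hω e he hrel i hi hin y z hyz hy hz
    have key := ih i hin hi ω hω e he
      (fun j => if j = 0 then y else if j = i then z else x j) (by simpa [hi.ne'] using hyz)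
      (fun j hj => ?_)
    · simpa [hi.ne'] using key
    · have h0 := hrel j (by omega)
      simp only [hj.ne, if_false, Nat.add_eq_zero_iff, one_ne_zero, and_false]
      refine h0.of_conn ?_ ?_
      · split_ifs with hj0
        · rw [hj0]; exact hy
        · exact .refl
      · split_ifs with hj0
        · rw [hj0]; exact hz
        · exact .refl
  have suffixRel : ∀ {ω : Config m}, Consistent S ω → ∀ {e : Edge m}, ω e = false →
      (∀ i < n, Rel S ω (x i) (x (i + 1))) → ∀ {i : ℕ}, 0 < i → i < n → ∀ {y z : V m},
      EndsAt e y z → Conn ω y (x i) → Conn ω (x n) z → Rel S ω y z := by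
    intro ω hω e he hrel i hi hin y z hyz hy hz
    have hni : 0 < n - i := by omega
    have key := ih (n - i) (by omega) hni ω hω e he
      (fun j => if j = 0 then y else if j = n - i then z else x (i + j))
      (by simpa [hni.ne'] using hyz) (fun j hj => ?_)
    · simpa [hni.ne'] using key
    · have h0 := hrel (i + j) (by omega)
      simp only [hj.ne, if_false, Nat.add_eq_zero_iff, one_ne_zero, and_false]
      refine h0.of_conn ?_ ?_
      · split_ifs with hj0
        · rw [hj0]; exact hy
        · exact .refl
      · split_ifs with hj0
        · rw [add_assoc, hj0, show i + (n - i) = n by omega]; exact hz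
        · rw [add_assoc]; exact .refl
  have main : ∀ z : V m, Conn (oneCfg m) z (x 1) → ∀ ω : Config m, Consistent S ω →
      ω e = false → (∀ i < n, Rel S ω (x i) (x (i + 1))) →
      (Conn ω z (x 0) ∨ Conn ω z (x n)) → Rel S ω (x 0) (x n) := by
    intro z hz
    induction hz using Relation.ReflTransGen.head_induction_on with
    | refl =>
      intro ω hω he hrel hz
      rcases hz with hz | hz
      · exact suffixRel hω he hrel one_pos hn2 hx hz.symm .refl
      · exact prefixRel hω he hrel one_pos hn2 hx .refl hz
    | @head a w hf _ ihw =>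
      intro ω hω he hrel hz
      by_cases hw : Conn ω w (x 0) ∨ Conn ω w (x n)
      · exact ihw ω hω he hrel hw
      obtain ⟨f, -, hf⟩ := hf
      have hfω : ω f = false := by
        by_contra hc
        have : Step ω w a := ⟨f, by simpa using hc, hf.symm⟩
        exact hw (hz.imp (.head this) (.head this))
      have hef : e ≠ f := by
        rintro rfl
        rcases hx.eq_or_eq hf.incident_right with h | h
        · exact hw (Or.inl (h ▸ .refl))
        · exact hw (Or.inr (h ▸ .refl))
      by_cases hU : ∃ i, 0 < i ∧ i < n ∧ Conn ω w (x i)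
      · obtain ⟨i, hi, hin, hwi⟩ := hU
        have hopen : Step (openE f ω) a w := ⟨f, by simp [openE], hf⟩
        have heo : openE f ω e = false := by simp [openE, hef, he]
        have hrel' : ∀ i < n, Rel S (openE f ω) (x i) (x (i + 1)) := fun j hj =>
          (hrel j hj).mono le_openE
        have hsq : SquareConsistent S ω := hω ω (by simp)
        rcases hz with hz | hz
        · refine hsq.rel hS hef he hfω hx hf
            (prefixRel hω hfω hrel hi hin hf hz hwi.symm) ?_
          refine suffixRel (hω.openE f) heo hrel' hi hin hx ?_ .refl
          exact (hz.symm.mono le_openE).trans (.head hopen (hwi.mono le_openE))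
        · refine hsq.rel hS hef he hfω hx hf.symm
            (suffixRel hω hfω hrel hi hin hf.symm hwi hz.symm) ?_
          refine prefixRel (hω.openE f) heo hrel' hi hin hx .refl ?_
          exact (hwi.symm.mono le_openE).trans (.head hopen.symm (hz.mono le_openE))
      · push Not at hU hw
        have hxw : ∀ i ≤ n, ¬ Conn ω (x i) w := fun i hi hc => by
          rcases Nat.eq_zero_or_pos i with rfl | hi0
          · exact hw.1 hc.symm
          · rcases eq_or_lt_of_le hi with rfl | hin
            · exact hw.2 hc.symm
            · exact hU i hi0 hin hc.symm
        have hxne : x 0 ≠ w := fun h => hw.1 (h ▸ .refl)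
        have hnw : x n ≠ w := fun h => hw.2 (h ▸ .refl)
        have hstep : Step (pendant f w ω) w a := ⟨f, by simp [pendant], hf.symm⟩
        refine rel_of_rel_pendant hf hxne hnw (ihw _ (hω.pendant f w) ?_ (fun i hi => ?_) ?_)
        · have : ¬ Incident e w := fun hi => (hx.eq_or_eq hi).elim (fun h => hxne h.symm)
            fun h => hnw h.symm
          simp [pendant, hef, this, he]
        · exact rel_pendant (hxw i hi.le) (hxw (i + 1) hi) (hrel i hi)
        · refine hz.imp (fun hz => .head hstep ?_) (fun hz => .head hstep ?_)
          · exact (conn_pendant (hxw 0 (Nat.zero_le _)) hz.symm).symm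
          · exact (conn_pendant (hxw n le_rfl) hz.symm).symm
  exact main (x 0) (conn_one _ _) ω hω he hrel (Or.inl .refl)

/-- Equivalence of vertices under open connections and related rays. -/
def Chain (S : Ray m → Ray m → Prop) (ω : Config m) : V m → V m → Prop :=
  Relation.ReflTransGen fun x y => Conn ω x y ∨ Rel S ω x y

lemma Chain.conn_or {ω : Config m} {x y : V m} (h : Chain S ω x y) :
    Conn ω x y ∨ ∃ n ≥ 1, ∃ f : ℕ → V m, f 0 = x ∧ f n = y ∧
      ∀ i < n, Rel S ω (f i) (f (i + 1)) := by
  induction h using Relation.ReflTransGen.head_induction_on with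
  | refl => exact Or.inl .refl
  | @head a c h _ ih =>
    rcases h with h | h
    · rcases ih with ih | ⟨n, hn, f, rfl, rfl, hf⟩
      · exact Or.inl (h.trans ih)
      · refine Or.inr ⟨n, hn, fun i => if i = 0 then a else f i, by simp, by simp; omega,
          fun i hi => ?_⟩
        refine (hf i hi).of_conn ?_ (by simpa using .refl)
        dsimp only
        split_ifs with h0
        · rwa [h0]
        · exact .refl
    · right
      rcases ih with ih | ⟨n, hn, f, rfl, rfl, hf⟩
      · exact ⟨1, le_rfl, fun i => if i = 0 then a else y, by simp, by simp, fun i hi => by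
          obtain rfl : i = 0 := by omega
          simpa using h.of_conn .refl ih⟩
      · refine ⟨n + 1, by omega, fun i => Nat.casesOn (motive := fun _ => V m) i a f, rfl, rfl, ?_⟩
        rintro (_ | i) hi
        · exact h
        · exact hf i (by omega)

lemma Consistent.rel_of_chain {ω : Config m} (hS : Equivalence S) (hω : Consistent S ω)
    {e : Edge m} (he : ω e = false) {x y : V m} (hxy : EndsAt e x y) (h : Chain S ω x y) :
    Rel S ω x y := by
  rcases h.conn_or with h | ⟨n, hn, f, rfl, rfl, hf⟩
  · exact absurd h (not_conn_of_closed he hxy)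
  · exact RCTree.rel_of_chain hS n hn ω hω e he f hxy hf

/-! ### Counting clusters -/

section Count

variable {α : Type*} {G G' : SimpleGraph α} {u v : α}

lemma reachable_of_adj_iff (hG : ∀ x y, G'.Adj x y ↔ G.Adj x y ∨ (x = u ∧ y = v) ∨ (x = v ∧ y = u))
    {x y : α} (h : G'.Reachable x y) : G.Reachable x y ∨ (G.Reachable x u ∧ G.Reachable v y) ∨
      (G.Reachable x v ∧ G.Reachable u y) := by
  rw [SimpleGraph.reachable_iff_reflTransGen] at h
  induction h with
  | refl => exact Or.inl .rfl
  | tail _ h ih =>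
    rcases (hG _ _).1 h with h | ⟨rfl, rfl⟩ | ⟨rfl, rfl⟩
    · exact ih.imp (·.trans h.reachable)
        (Or.imp (fun i => ⟨i.1, i.2.trans h.reachable⟩) fun i => ⟨i.1, i.2.trans h.reachable⟩)
    · rcases ih with i | i | i
      · exact Or.inr (Or.inl ⟨i, .rfl⟩)
      · exact Or.inr (Or.inl ⟨i.1, .rfl⟩)
      · exact Or.inl i.1
    · rcases ih with i | i | i
      · exact Or.inr (Or.inr ⟨i, .rfl⟩)
      · exact Or.inl i.1
      · exact Or.inr (Or.inr ⟨i.1, .rfl⟩)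

lemma card_component_of_reachable
    (hG : ∀ x y, G'.Adj x y ↔ G.Adj x y ∨ (x = u ∧ y = v) ∨ (x = v ∧ y = u))
    (h : G.Reachable u v) : Nat.card G'.ConnectedComponent = Nat.card G.ConnectedComponent := by
  have hle : G ≤ G' := fun x y hxy => (hG x y).2 (Or.inl hxy)
  refine (Nat.card_congr (Equiv.ofBijective
    (SimpleGraph.ConnectedComponent.map (SimpleGraph.Hom.ofLE hle)) ⟨?_, ?_⟩)).symm
  · intro c d
    induction c using SimpleGraph.ConnectedComponent.ind
    induction d using SimpleGraph.ConnectedComponent.ind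
    intro hcd
    simp only [SimpleGraph.ConnectedComponent.map_mk, SimpleGraph.Hom.coe_ofLE, id_eq,
      SimpleGraph.ConnectedComponent.eq] at hcd ⊢
    rcases reachable_of_adj_iff hG hcd with i | i | i
    · exact i
    · exact i.1.trans (h.trans i.2)
    · exact i.1.trans (h.symm.trans i.2)
  · exact SimpleGraph.ConnectedComponent.surjective_map_ofLE hle

lemma card_component_of_not_reachable [Finite α]
    (hG : ∀ x y, G'.Adj x y ↔ G.Adj x y ∨ (x = u ∧ y = v) ∨ (x = v ∧ y = u))
    (h : ¬ G.Reachable u v) :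
    Nat.card G.ConnectedComponent = Nat.card G'.ConnectedComponent + 1 := by
  classical
  have hle : G ≤ G' := fun x y hxy => (hG x y).2 (Or.inl hxy)
  have hadj : G'.Adj u v := (hG u v).2 (Or.inr (Or.inl ⟨rfl, rfl⟩))
  let f : {c : G.ConnectedComponent // c ≠ G.connectedComponentMk v} → G'.ConnectedComponent :=
    fun c => c.1.map (SimpleGraph.Hom.ofLE hle)
  have hf : Function.Bijective f := by
    constructor
    · rintro ⟨c, hc⟩ ⟨d, hd⟩
      induction c using SimpleGraph.ConnectedComponent.ind
      induction d using SimpleGraph.ConnectedComponent.ind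
      intro hcd
      simp only [f, ne_eq, SimpleGraph.ConnectedComponent.map_mk, SimpleGraph.Hom.coe_ofLE, id_eq,
        SimpleGraph.ConnectedComponent.eq, Subtype.mk.injEq] at hcd hc hd ⊢
      rcases reachable_of_adj_iff hG hcd with i | i | i
      · exact i
      · exact absurd i.2.symm hd
      · exact absurd i.1 hc
    · intro c
      induction c using SimpleGraph.ConnectedComponent.ind with
      | _ x =>
      by_cases hx : G.Reachable x v
      · refine ⟨⟨G.connectedComponentMk u, by simpa using h⟩, ?_⟩
        simp only [f, SimpleGraph.ConnectedComponent.map_mk, SimpleGraph.Hom.coe_ofLE, id_eq,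
          SimpleGraph.ConnectedComponent.eq]
        exact hadj.reachable.trans (hx.mono hle).symm
      · exact ⟨⟨G.connectedComponentMk x, by simpa using hx⟩, rfl⟩
  rw [← Nat.card_congr (Equiv.ofBijective f hf)]
  have : Fintype G.ConnectedComponent := Fintype.ofFinite _
  rw [Nat.card_eq_fintype_card, Nat.card_eq_fintype_card, Fintype.card_subtype_compl,
    Fintype.card_subtype_eq]
  have : 0 < Fintype.card G.ConnectedComponent := Fintype.card_pos_iff.2 ⟨G.connectedComponentMk v⟩
  omega

end Count

/-- The augmented graph on `Λ`. -/
def augGraph (S : Ray m → Ray m → Prop) (Λ : Finset (V m)) (ω : Config m) :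
    SimpleGraph {x // x ∈ Λ} :=
  SimpleGraph.fromRel fun u v : {x // x ∈ Λ} => augRel S Λ ω ↑u ↑v

lemma kCount_eq (Λ : Finset (V m)) (ω : Config m) :
    kCount S Λ ω = Nat.card (augGraph S Λ ω).ConnectedComponent := rfl

lemma augRel_symm (hS : Equivalence S) {Λ : Finset (V m)} {ω : Config m} {u v : V m}
    (h : augRel S Λ ω u v) : augRel S Λ ω v u := by
  rw [augRel_iff] at h ⊢
  rcases h with ⟨e, h1, h2, h3⟩ | h | h
  exacts [Or.inl ⟨e, h1, h2, h3.symm⟩, Or.inr (Or.inl h.symm), Or.inr (Or.inr (h.symm hS))]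

lemma augGraph_adj (hS : Equivalence S) {Λ : Finset (V m)} {ω : Config m} {u v : {x // x ∈ Λ}} :
    (augGraph S Λ ω).Adj u v ↔ u ≠ v ∧ augRel S Λ ω ↑u ↑v := by
  simp only [augGraph, SimpleGraph.fromRel_adj]
  exact and_congr_right fun _ => ⟨fun h => h.elim id (augRel_symm hS), Or.inl⟩

lemma reachable_of_augRel (hS : Equivalence S) {Λ : Finset (V m)} {ω : Config m}
    {u v : {x // x ∈ Λ}} (h : augRel S Λ ω ↑u ↑v) : (augGraph S Λ ω).Reachable u v := by
  by_cases huv : u = v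
  · subst huv; rfl
  · exact ((augGraph_adj hS).2 ⟨huv, h⟩).reachable

lemma offCfg_le {Λ : Set (V m)} {ω : Config m} (e : Edge m) (he : offCfg Λ ω e = true) :
    ω e = true := (offCfg_eq_true.1 he).2

lemma offCfg_openE {Λ : Set (V m)} {ω : Config m} {e : Edge m} (he : e ∈ ELam Λ) :
    offCfg Λ (openE e ω) = offCfg Λ (closeE e ω) := by
  ext f
  by_cases hf : f = e
  · subst hf; simp [offCfg, he]
  · simp [offCfg, openE, closeE, hf]

lemma augGraph_openE (hS : Equivalence S) {Λ : Finset (V m)} {ω : Config m} {e : Edge m}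
    (he : e ∈ ELam (↑Λ : Set (V m))) (x y : {x // x ∈ Λ}) :
    (augGraph S Λ (openE e ω)).Adj x y ↔ (augGraph S Λ (closeE e ω)).Adj x y ∨
      (x = ⟨parentV e, he.1⟩ ∧ y = ⟨childV e, he.2⟩) ∨
      (x = ⟨childV e, he.2⟩ ∧ y = ⟨parentV e, he.1⟩) := by
  rw [augGraph_adj hS, augGraph_adj hS, augRel_iff, augRel_iff, offCfg_openE he]
  constructor
  · rintro ⟨hne, ⟨f, h1, h2, h3⟩ | h⟩
    · by_cases hf : f = e
      · subst hf
        right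
        rcases h3 with ⟨h4, h5⟩ | ⟨h4, h5⟩
        · exact Or.inl ⟨Subtype.ext h4.symm, Subtype.ext h5.symm⟩
        · exact Or.inr ⟨Subtype.ext h5.symm, Subtype.ext h4.symm⟩
      · refine Or.inl ⟨hne, Or.inl ⟨f, h1, ?_, h3⟩⟩
        simpa [openE, closeE, hf] using h2
    · exact Or.inl ⟨hne, Or.inr h⟩
  · rintro (⟨hne, ⟨f, h1, h2, h3⟩ | h⟩ | ⟨rfl, rfl⟩ | ⟨rfl, rfl⟩)
    · refine ⟨hne, Or.inl ⟨f, h1, ?_, h3⟩⟩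
      by_cases hf : f = e
      · simp [openE, hf]
      · simpa [openE, closeE, hf] using h2
    · exact ⟨hne, Or.inr h⟩
    · exact ⟨fun h => parentV_ne_childV e (congrArg Subtype.val h),
        Or.inl ⟨e, he, by simp [openE], endsAt_self e⟩⟩
    · exact ⟨fun h => parentV_ne_childV e (congrArg Subtype.val h).symm,
        Or.inl ⟨e, he, by simp [openE], (endsAt_self e).symm⟩⟩

lemma chain_of_reachable (hS : Equivalence S) {Λ : Finset (V m)} {ω : Config m}
    {x y : {x // x ∈ Λ}} (h : (augGraph S Λ ω).Reachable x y) : Chain S ω ↑x ↑y := by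
  rw [SimpleGraph.reachable_iff_reflTransGen] at h
  induction h with
  | refl => exact .refl
  | tail _ h ih =>
    refine .tail ih ?_
    rcases augRel_iff.1 ((augGraph_adj hS).1 h).2 with ⟨e, -, h1, h2⟩ | h | h
    · exact Or.inl (.single ⟨e, h1, h2⟩)
    · exact Or.inl (h.mono offCfg_le)
    · exact Or.inr (h.mono offCfg_le)

lemma exists_last_exit (hS : Equivalence S) {Λ : Finset (V m)} {ω : Config m} {x : {x // x ∈ Λ}}
    {z : V m} (h : Conn ω ↑x z) :
    ∃ x' : {x // x ∈ Λ}, (augGraph S Λ ω).Reachable x x' ∧ Conn (offCfg ↑Λ ω) ↑x' z := by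
  induction h with
  | refl => exact ⟨x, .rfl, .refl⟩
  | tail _ h ih =>
    obtain ⟨x', h1, h2⟩ := ih
    obtain ⟨e, he, hxy⟩ := h
    by_cases heΛ : e ∈ ELam (↑Λ : Set (V m))
    · rename_i b c _
      have hb : b ∈ Λ ∧ c ∈ Λ := by
        rcases hxy with ⟨rfl, rfl⟩ | ⟨rfl, rfl⟩
        · exact heΛ
        · exact heΛ.symm
      refine ⟨⟨c, hb.2⟩, h1.trans ?_, .refl⟩
      have r1 : (augGraph S Λ ω).Reachable x' ⟨b, hb.1⟩ :=
        reachable_of_augRel hS (augRel_iff.2 (Or.inr (Or.inl h2)))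
      exact r1.trans (reachable_of_augRel hS (augRel_iff.2 (Or.inl ⟨e, heΛ, he, hxy⟩)))
    · exact ⟨x', h1, .tail h2 ⟨e, offCfg_eq_true.2 ⟨heΛ, he⟩, hxy⟩⟩

lemma exists_last_exit_lim (hS : Equivalence S) {Λ : Finset (V m)} {ω : Config m}
    {x : {x // x ∈ Λ}} {ρ : Ray m} (h : Lim ω ↑x ρ) :
    ∃ x' : {x // x ∈ Λ}, (augGraph S Λ ω).Reachable x x' ∧ Lim (offCfg ↑Λ ω) ↑x' ρ := by
  obtain ⟨N, hN⟩ := h.eventually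
  have hfin : {n | rayVtx ρ n ∈ Λ}.Finite :=
    Λ.finite_toSet.preimage (rayVtx_injective ρ).injOn
  obtain ⟨M, hM⟩ := hfin.bddAbove
  have hout : ∀ n ≥ max N (M + 1), offCfg ↑Λ ω (rayEdge ρ n) = true := fun n hn => by
    refine offCfg_eq_true.2 ⟨fun h => ?_, (hN n ((le_max_left _ _).trans hn)).1⟩
    have h1 := h.1
    rw [parentV_rayEdge] at h1
    have := hM h1
    have := (le_max_right _ _).trans hn
    omega
  obtain ⟨x', h1, h2⟩ := exists_last_exit hS (hN _ (le_max_left N (M + 1))).2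
  exact ⟨x', h1, _, hout, h2⟩

lemma reachable_of_rel (hS : Equivalence S) {Λ : Finset (V m)} {ω : Config m}
    {x y : {x // x ∈ Λ}} (h : Rel S ω ↑x ↑y) : (augGraph S Λ ω).Reachable x y := by
  obtain ⟨ρ, ρ', h1, h2, h3⟩ := h
  obtain ⟨x', hx, h1⟩ := exists_last_exit_lim hS h1
  obtain ⟨y', hy, h2⟩ := exists_last_exit_lim hS h2
  exact hx.trans ((reachable_of_augRel hS
    (augRel_iff.2 (Or.inr (Or.inr ⟨ρ, ρ', h1, h2, h3⟩)))).trans hy.symm)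

lemma kCount_openE_of_mem (hS : Equivalence S) {Λ : Finset (V m)} {ω : Config m} {e : Edge m}
    (he : e ∈ ELam (↑Λ : Set (V m))) (h : ω ∈ KEdge S e) :
    kCount S Λ (openE e ω) = kCount S Λ (closeE e ω) := by
  rw [kCount_eq, kCount_eq]
  refine card_component_of_reachable (augGraph_openE hS he) ?_
  exact reachable_of_rel hS (mem_kEdge_iff.1 h)

lemma kCount_closeE_of_notMem (hS : Equivalence S) {Λ : Finset (V m)} {ω : Config m} {e : Edge m}
    (hω : Consistent S ω) (he : e ∈ ELam (↑Λ : Set (V m))) (h : ω ∉ KEdge S e) :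
    kCount S Λ (closeE e ω) = kCount S Λ (openE e ω) + 1 := by
  rw [kCount_eq, kCount_eq]
  refine card_component_of_not_reachable (augGraph_openE hS he) fun hr => h ?_
  exact mem_kEdge_iff.2 ((hω.closeE e).rel_of_chain hS (by simp [closeE]) (endsAt_self e)
    (chain_of_reachable hS hr))

lemma kCount_pair_closeE_of_notMem (hS : Equivalence S) {ω : Config m} {e : Edge m}
    (h : ω ∉ KEdge S e) :
    kCount S {parentV e, childV e} (closeE e ω) =
      kCount S {parentV e, childV e} (openE e ω) + 1 := by
  have he : e ∈ ELam (↑({parentV e, childV e} : Finset (V m)) : Set (V m)) := by simp [ELam]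
  rw [kCount_eq, kCount_eq]
  refine card_component_of_not_reachable (augGraph_openE hS he) fun hr => h ?_
  have hoff : offCfg ↑({parentV e, childV e} : Finset (V m)) (closeE e ω) = closeE e ω := by
    simp only [Finset.coe_insert, Finset.coe_singleton]
    rw [offCfg_pair]
    simp [closeE]
  rw [SimpleGraph.reachable_iff_reflTransGen] at hr
  rcases hr.cases_head with heq | ⟨z, hz, -⟩
  · exact absurd (congrArg Subtype.val heq) (parentV_ne_childV e)
  · obtain ⟨hne, hz⟩ := (augGraph_adj hS).1 hz
    have hz' : z.1 = childV e := by
      rcases Finset.mem_insert.1 z.2 with hz' | hz'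
      · exact absurd (Subtype.ext hz'.symm) hne
      · simpa using hz'
    rw [augRel_iff, hoff, hz'] at hz
    rw [mem_kEdge_iff]
    have hnc : ¬ Conn (closeE e ω) (parentV e) (childV e) :=
      not_conn_of_closed (by simp [closeE]) (endsAt_self e)
    rcases hz with ⟨f, -, h1, h2⟩ | hz | hz
    · exact absurd (.single ⟨f, h1, h2⟩) hnc
    · exact absurd hz hnc
    · exact hz

/-! ### Measurability -/

lemma measurableSet_conn (u v : V m) : MeasurableSet {ω : Config m | Conn ω u v} := by
  let A : ℕ → V m → Set (Config m) := fun n => Nat.rec (motive := fun _ => V m → Set (Config m))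
    (fun v => {_ω | u = v})
    (fun _ B v => ⋃ w, B w ∩ ⋃ e : Edge m, {ω | ω e = true ∧ EndsAt e w v}) n
  have hA : ∀ n v, MeasurableSet (A n v) := by
    intro n
    induction n with
    | zero => exact fun v => MeasurableSet.const _
    | succ n ih =>
      refine fun v => .iUnion fun w => (ih w).inter (.iUnion fun e => ?_)
      exact (measurableSet_eq_fun (measurable_pi_apply e) measurable_const).inter (.const _)
  have : {ω : Config m | Conn ω u v} = ⋃ n, A n v := by
    ext ω
    simp only [Set.mem_ofPred_eq, Set.mem_iUnion]
    constructor
    · intro h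
      induction h with
      | refl => exact ⟨0, rfl⟩
      | @tail b c _ h ih =>
        obtain ⟨n, hn⟩ := ih
        obtain ⟨e, he, h⟩ := h
        exact ⟨n + 1, Set.mem_iUnion.2 ⟨b, hn, Set.mem_iUnion.2 ⟨e, he, h⟩⟩⟩
    · rintro ⟨n, hn⟩
      induction n generalizing v with
      | zero =>
        obtain rfl : u = v := hn
        exact .refl
      | succ n ih =>
        obtain ⟨w, hw, h⟩ := Set.mem_iUnion.1 hn
        obtain ⟨e, he, h⟩ := Set.mem_iUnion.1 h
        exact .tail (ih w hw) ⟨e, he, h⟩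
  rw [this]
  exact .iUnion fun n => hA n v

lemma measurable_offCfg (Λ : Set (V m)) : Measurable (offCfg Λ : Config m → Config m) := by
  refine measurable_pi_lambda _ fun e => ?_
  simp only [offCfg]
  split_ifs
  · exact measurable_const
  · exact measurable_pi_apply e

/-- The measurability hypothesis on the relation `S`. -/
def MeasRel (S : Ray m → Ray m → Prop) : Prop :=
  ∀ Λ : Set (V m), Λ.Finite → ∀ u ∈ Λ, ∀ v ∈ Λ, MeasurableSet (KEvent S Λ u v)

lemma measurableSet_kEdge (hS : MeasRel S) (e : Edge m) : MeasurableSet (KEdge S e) :=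
  hS _ (Set.toFinite _) _ (by simp) _ (by simp)

lemma measurableSet_augRel (hS : MeasRel S) (Λ : Finset (V m)) {u v : V m} (hu : u ∈ Λ)
    (hv : v ∈ Λ) : MeasurableSet {ω | augRel S Λ ω u v} := by
  have h1 : MeasurableSet
      {ω : Config m | ∃ e ∈ ELam (↑Λ : Set (V m)), ω e = true ∧ EndsAt e u v} := by
    have : {ω : Config m | ∃ e ∈ ELam (↑Λ : Set (V m)), ω e = true ∧ EndsAt e u v} =
        ⋃ e : Edge m, {ω | e ∈ ELam (↑Λ : Set (V m)) ∧ ω e = true ∧ EndsAt e u v} := by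
      ext; simp
    rw [this]
    exact .iUnion fun e => (MeasurableSet.const _).inter
      ((measurableSet_eq_fun (measurable_pi_apply e) measurable_const).inter (.const _))
  have h2 : MeasurableSet {ω : Config m | OutConn (↑Λ : Set (V m)) ω u v} := by
    simp only [outConn_iff]
    exact measurable_offCfg _ (measurableSet_conn u v)
  exact h1.union (h2.union (hS _ Λ.finite_toSet u hu v hv))

lemma measurable_kCount (hS : MeasRel S) (Λ : Finset (V m)) : Measurable (kCount S Λ) := by
  let F : ({x // x ∈ Λ} → {x // x ∈ Λ} → Prop) → ℕ := fun r =>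
    Nat.card (SimpleGraph.fromRel r).ConnectedComponent
  have hF : Measurable F := measurable_of_countable F
  refine hF.comp (measurable_pi_lambda _ fun u => measurable_pi_lambda _ fun v => ?_)
  exact measurable_to_prop (by
    simpa [Set.preimage] using measurableSet_augRel hS Λ u.2 v.2)

lemma measurable_rcWeight (hS : MeasRel S) (p q : ℝ) (Λ : Finset (V m)) :
    Measurable (rcWeight S p q Λ) := by
  refine Measurable.mul (Finset.measurable_prod _ fun e _ => ?_) ?_
  · exact (measurable_of_countable fun b : Bool => ENNReal.ofReal (if b then p else 1 - p)).comp
      (measurable_pi_apply e)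
  · exact (measurable_of_countable fun k : ℕ => ENNReal.ofReal q ^ k).comp
      (measurable_kCount hS Λ)

lemma comap_restrict_le (P : Edge m → Prop) :
    MeasurableSpace.comap (fun (ω : Config m) (e : {e // P e}) => ω ↑e) inferInstance ≤
      (inferInstance : MeasurableSpace (Config m)) := by
  rintro _ ⟨s, hs, rfl⟩
  exact measurable_pi_lambda _ (fun e => measurable_pi_apply _) hs

open Classical in
lemma measurable_comap_restrict {P : Edge m → Prop} {β : Type*} [MeasurableSpace β]
    {f : Config m → β} (hf : Measurable f)
    (hinv : ∀ ω ω' : Config m, (∀ e, P e → ω e = ω' e) → f ω = f ω') :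
    Measurable[MeasurableSpace.comap (fun (ω : Config m) (e : {e // P e}) => ω ↑e)
      inferInstance] f := by
  let ext : ({e // P e} → Bool) → Config m := fun σ e => if h : P e then σ ⟨e, h⟩ else false
  have hext : Measurable ext := by
    refine measurable_pi_lambda _ fun e => ?_
    simp only [ext]
    split_ifs
    · exact measurable_pi_apply _
    · exact measurable_const
  have : f = (f ∘ ext) ∘ fun (ω : Config m) (e : {e // P e}) => ω ↑e := by
    ext ω
    exact hinv _ _ fun e he => by simp [ext, he]
  rw [this]
  exact (hf.comp hext).comp (comap_measurable _)

lemma mem_iff_of_measurableSet_comap {P : Edge m → Prop} {B : Set (Config m)}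
    (hB : MeasurableSet[MeasurableSpace.comap (fun (ω : Config m) (e : {e // P e}) => ω ↑e)
      inferInstance] B) {ω ω' : Config m} (h : ∀ e, P e → ω e = ω' e) : ω ∈ B ↔ ω' ∈ B := by
  obtain ⟨s, -, rfl⟩ := hB
  simp only [Set.mem_preimage]
  rw [show (fun e : {e // P e} => ω e.1) = fun e : {e // P e} => ω' e.1 from
    funext fun e => h e.1 e.2]

lemma measurableSet_comap_restrict {P : Edge m → Prop} {B : Set (Config m)} (hB : MeasurableSet B)
    (hinv : ∀ ω ω' : Config m, (∀ e, P e → ω e = ω' e) → (ω ∈ B ↔ ω' ∈ B)) :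
    MeasurableSet[MeasurableSpace.comap (fun (ω : Config m) (e : {e // P e}) => ω ↑e)
      inferInstance] B := by
  have h := measurable_comap_restrict (P := P) (f := (· ∈ B)) (measurable_mem.2 hB)
    fun ω ω' h => propext (hinv ω ω' h)
  simpa using h (MeasurableSet.singleton True)

lemma outSigmaE_le (e : Edge m) : outSigmaE e ≤ (inferInstance : MeasurableSpace (Config m)) :=
  comap_restrict_le _

lemma outSigma_le (Λ : Finset (V m)) :
    outSigma Λ ≤ (inferInstance : MeasurableSpace (Config m)) :=
  comap_restrict_le _

lemma measurableSet_jEdge (e : Edge m) : MeasurableSet (JEdge e) :=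
  measurableSet_eq_fun (measurable_pi_apply e) measurable_const

lemma measurable_openE (e : Edge m) : Measurable (openE e : Config m → Config m) := by
  refine measurable_pi_lambda _ fun f => ?_
  simp only [openE, Function.update_apply]
  split_ifs
  · exact measurable_const
  · exact measurable_pi_apply f

lemma measurable_closeE (e : Edge m) : Measurable (closeE e : Config m → Config m) := by
  refine measurable_pi_lambda _ fun f => ?_
  simp only [closeE, Function.update_apply]
  split_ifs
  · exact measurable_const
  · exact measurable_pi_apply f

lemma openE_congr {e : Edge m} {ω ω' : Config m} (h : ∀ f, f ≠ e → ω f = ω' f) :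
    openE e ω = openE e ω' := by
  ext f
  by_cases hf : f = e
  · subst hf; simp [openE]
  · simp [openE, hf, h f hf]

lemma closeE_congr {e : Edge m} {ω ω' : Config m} (h : ∀ f, f ≠ e → ω f = ω' f) :
    closeE e ω = closeE e ω' := by
  ext f
  by_cases hf : f = e
  · subst hf; simp [closeE]
  · simp [closeE, hf, h f hf]

lemma mem_kEdge_congr {e : Edge m} {ω ω' : Config m} (h : ∀ f, f ≠ e → ω f = ω' f) :
    ω ∈ KEdge S e ↔ ω' ∈ KEdge S e := by
  rw [mem_kEdge_iff, mem_kEdge_iff, closeE_congr h]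

lemma measurableSet_outSigmaE_kEdge (hS : MeasRel S) (e : Edge m) :
    MeasurableSet[outSigmaE e] (KEdge S e) :=
  measurableSet_comap_restrict (measurableSet_kEdge hS e) fun _ _ h => mem_kEdge_congr h

lemma openE_of_open {e : Edge m} {ω : Config m} (he : ω e = true) : openE e ω = ω := by
  simp [openE, ← he]

@[simp] lemma openE_apply_self (e : Edge m) (ω : Config m) : openE e ω e = true := by
  simp [openE]

@[simp] lemma closeE_apply_self (e : Edge m) (ω : Config m) : closeE e ω e = false := by
  simp [closeE]

lemma openE_apply_of_ne {e f : Edge m} (h : f ≠ e) (ω : Config m) : openE e ω f = ω f := by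
  simp [openE, h]

lemma closeE_apply_of_ne {e f : Edge m} (h : f ≠ e) (ω : Config m) : closeE e ω f = ω f := by
  simp [closeE, h]

lemma openE_comm (e f : Edge m) (ω : Config m) : openE e (openE f ω) = openE f (openE e ω) := by
  ext g
  simp only [openE, Function.update_apply]
  split_ifs <;> rfl

@[simp] lemma closeE_openE (e : Edge m) (ω : Config m) : closeE e (openE e ω) = closeE e ω :=
  closeE_congr fun _ h => openE_apply_of_ne h ω

lemma mem_edgeFinset {Λ : Finset (V m)} {e : Edge m} :
    e ∈ EdgeFinset Λ ↔ e ∈ ELam (↑Λ : Set (V m)) := by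
  have h : e ∈ Λ.preimage (childV : Edge m → V m) (Option.some_injective _).injOn ↔ childV e ∈ Λ :=
    Finset.mem_preimage
  rw [EdgeFinset, Finset.mem_filter]
  exact (and_congr_left' h).trans and_comm

lemma edgeFinset_pair (e : Edge m) : EdgeFinset {parentV e, childV e} = {e} := by
  ext f
  rw [mem_edgeFinset]
  simp [eLam_pair]

/-! ### Finite-volume measures -/

/-- The configuration agreeing with `ω` off `E` and whose open edges in `E` are those of `F`. -/
def setCfg (E F : Finset (Edge m)) (ω : Config m) : Config m :=
  fun e => if e ∈ E then decide (e ∈ F) else ω e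

lemma setCfg_congr {E F : Finset (Edge m)} {ω ω' : Config m} (h : ∀ e, e ∉ E → ω e = ω' e) :
    setCfg E F ω = setCfg E F ω' := by
  ext e
  simp only [setCfg]
  split_ifs with he
  · rfl
  · exact h e he

lemma setCfg_of_notMem {E F : Finset (Edge m)} {ω : Config m} {e : Edge m} (h : e ∉ E) :
    setCfg E F ω e = ω e := by
  simp [setCfg, h]

lemma setCfg_setCfg (E F F' : Finset (Edge m)) (ω : Config m) :
    setCfg E F (setCfg E F' ω) = setCfg E F ω :=
  setCfg_congr fun _ he => setCfg_of_notMem he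

lemma measurable_setCfg (E F : Finset (Edge m)) :
    Measurable (setCfg E F : Config m → Config m) := by
  refine measurable_pi_lambda _ fun e => ?_
  simp only [setCfg]
  split_ifs
  · exact measurable_const
  · exact measurable_pi_apply e

open Classical in
lemma rcUnnorm_apply (p q : ℝ) (Λ : Finset (V m)) (ξ : Config m) {A : Set (Config m)}
    (hA : MeasurableSet A) : rcUnnorm S p q Λ ξ A =
      ∑ F ∈ (EdgeFinset Λ).powerset, rcWeight S p q Λ (setCfg (EdgeFinset Λ) F ξ) *
        A.indicator 1 (setCfg (EdgeFinset Λ) F ξ) := by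
  let E := EdgeFinset Λ
  let Φ : {F // F ∈ E.powerset} ≃ {ω : Config m // ω ∈ cylinderSet Λ ξ} :=
    { toFun := fun F => ⟨setCfg E F.1 ξ, fun e he => setCfg_of_notMem (by rwa [mem_edgeFinset])⟩
      invFun := fun ω => ⟨E.filter fun e => ω.1 e = true, by simp⟩
      left_inv := by
        rintro ⟨F, hF⟩
        rw [Finset.mem_powerset] at hF
        ext e
        simp only [setCfg, Finset.mem_filter]
        constructor
        · rintro ⟨h1, h2⟩; simpa [h1] using h2
        · intro h; simp [hF h, h]
      right_inv := by
        rintro ⟨ω, hω⟩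
        ext e
        by_cases he : e ∈ E
        · simp [setCfg, he]
        · have := hω e (by rwa [← mem_edgeFinset])
          simp [setCfg, he, this] }
  rw [rcUnnorm, Measure.sum_apply _ hA, ← Φ.tsum_eq, tsum_fintype]
  refine Eq.trans (Finset.sum_congr rfl fun F _ => ?_)
    (Finset.sum_coe_sort E.powerset fun F => rcWeight S p q Λ (setCfg E F ξ) *
      A.indicator 1 (setCfg E F ξ))
  rw [Measure.smul_apply, Measure.dirac_apply' _ hA, smul_eq_mul]
  rfl

lemma rcFin_apply (p q : ℝ) (Λ : Finset (V m)) (ξ : Config m) {A : Set (Config m)}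
    (hA : MeasurableSet A) : rcFin S p q Λ ξ A =
      (∑ F ∈ (EdgeFinset Λ).powerset, rcWeight S p q Λ (setCfg (EdgeFinset Λ) F ξ))⁻¹ *
      ∑ F ∈ (EdgeFinset Λ).powerset, rcWeight S p q Λ (setCfg (EdgeFinset Λ) F ξ) *
        A.indicator 1 (setCfg (EdgeFinset Λ) F ξ) := by
  rw [rcFin, Measure.smul_apply, smul_eq_mul, rcUnnorm_apply p q Λ ξ hA,
    rcUnnorm_apply p q Λ ξ MeasurableSet.univ]
  simp

lemma rcWeight_ne_top (p q : ℝ) (Λ : Finset (V m)) (ω : Config m) :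
    rcWeight S p q Λ ω ≠ ⊤ :=
  ENNReal.mul_ne_top (ENNReal.prod_ne_top fun _ _ => ENNReal.ofReal_ne_top)
    (ENNReal.pow_ne_top ENNReal.ofReal_ne_top)

lemma rcWeight_ne_zero {p q : ℝ} (hp0 : 0 < p) (hp1 : p < 1) (hq : 0 < q) (Λ : Finset (V m))
    (ω : Config m) : rcWeight S p q Λ ω ≠ 0 := by
  refine mul_ne_zero (Finset.prod_ne_zero_iff.2 fun e _ => ?_) (pow_ne_zero _ ?_)
  · rw [ne_eq, ENNReal.ofReal_eq_zero, not_le]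
    split_ifs
    · exact hp0
    · linarith
  · rwa [ne_eq, ENNReal.ofReal_eq_zero, not_le]

/-- The weights with `e` open and with `e` closed share the factor of the other edges. -/
lemma rcWeight_split (p q : ℝ) {Λ : Finset (V m)} {e : Edge m} (he : e ∈ EdgeFinset Λ)
    (ω : Config m) : ∃ R : ℝ≥0∞,
      rcWeight S p q Λ (openE e ω) =
        ENNReal.ofReal p * R * ENNReal.ofReal q ^ kCount S Λ (openE e ω) ∧
      rcWeight S p q Λ (closeE e ω) =
        ENNReal.ofReal (1 - p) * R * ENNReal.ofReal q ^ kCount S Λ (closeE e ω) := by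
  refine ⟨∏ f ∈ (EdgeFinset Λ).erase e, ENNReal.ofReal (if ω f then p else 1 - p), ?_, ?_⟩
  all_goals
    rw [rcWeight, ← Finset.mul_prod_erase _ _ he]
    congr 2
    · simp
    · refine Finset.prod_congr rfl fun f hf => ?_
      have := Finset.ne_of_mem_erase hf
      simp [openE, closeE, this]

/-! ### Single-edge conditional probabilities -/

open Classical in
/-- The conditional probability that `e` is open. -/
noncomputable def openProb (S : Ray m → Ray m → Prop) (p q : ℝ) (e : Edge m) (ω : Config m) :
    ℝ≥0∞ :=
  if ω ∈ KEdge S e then ENNReal.ofReal p else ENNReal.ofReal (p / (p + q * (1 - p)))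

open Classical in
/-- The conditional probability that `e` is closed. -/
noncomputable def closedProb (S : Ray m → Ray m → Prop) (p q : ℝ) (e : Edge m) (ω : Config m) :
    ℝ≥0∞ :=
  if ω ∈ KEdge S e then ENNReal.ofReal (1 - p) else ENNReal.ofReal (1 - p / (p + q * (1 - p)))

open Classical in
/-- The conditional odds that `e` is open. -/
noncomputable def odds (S : Ray m → Ray m → Prop) (p q : ℝ) (e : Edge m) (ω : Config m) : ℝ≥0∞ :=
  if ω ∈ KEdge S e then ENNReal.ofReal (p / (1 - p)) else ENNReal.ofReal (p / ((1 - p) * q))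

/-- The single-edge conditional probabilities of `φ` are given by `openProb`. -/
def SingleEdge (S : Ray m → Ray m → Prop) (p q : ℝ) (φ : Measure (Config m)) : Prop :=
  ∀ e : Edge m, ∀ B : Set (Config m), MeasurableSet[outSigmaE e] B →
    φ (JEdge e ∩ B) = ∫⁻ ξ in B, openProb S p q e ξ ∂φ

section

variable {p q : ℝ} {φ : Measure (Config m)}

open Classical in
lemma measurable_ite_kEdge (hS : MeasRel S) (e : Edge m) (a b : ℝ≥0∞) :
    Measurable[outSigmaE e] fun ω => if ω ∈ KEdge S e then a else b :=
  @Measurable.ite _ _ (fun _ => a) (fun _ => b) (outSigmaE e) _ (· ∈ KEdge S e) _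
    (measurableSet_outSigmaE_kEdge hS e) measurable_const measurable_const

lemma measurable_openProb (hS : MeasRel S) (p q : ℝ) (e : Edge m) :
    Measurable (openProb S p q e) :=
  (measurable_ite_kEdge hS e _ _).mono (outSigmaE_le e) le_rfl

lemma measurable_closedProb (hS : MeasRel S) (p q : ℝ) (e : Edge m) :
    Measurable (closedProb S p q e) :=
  (measurable_ite_kEdge hS e _ _).mono (outSigmaE_le e) le_rfl

lemma measurable_odds_outSigmaE (hS : MeasRel S) (p q : ℝ) (e : Edge m) :
    Measurable[outSigmaE e] (odds S p q e) :=
  measurable_ite_kEdge hS e _ _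

lemma measurable_odds (hS : MeasRel S) (p q : ℝ) (e : Edge m) : Measurable (odds S p q e) :=
  (measurable_odds_outSigmaE hS p q e).mono (outSigmaE_le e) le_rfl

lemma odds_ne_zero (hp0 : 0 < p) (hp1 : p < 1) (hq : 0 < q) (e : Edge m) (ω : Config m) :
    odds S p q e ω ≠ 0 := by
  have : 0 < 1 - p := by linarith
  rw [odds]
  split_ifs <;> rw [ne_eq, ENNReal.ofReal_eq_zero, not_le] <;> positivity

lemma closedProb_mul_odds (hp0 : 0 < p) (hp1 : p < 1) (hq : 0 < q) (e : Edge m) (ω : Config m) :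
    closedProb S p q e ω * odds S p q e ω = openProb S p q e ω := by
  have h1 : 0 < 1 - p := by linarith
  have h2 : 0 < p + q * (1 - p) := by positivity
  have h3 : 1 - p / (p + q * (1 - p)) = q * (1 - p) / (p + q * (1 - p)) := by
    field_simp
    ring
  rw [closedProb, odds, openProb, h3]
  split_ifs <;> rw [← ENNReal.ofReal_mul (by positivity)] <;> congr 1 <;> field_simp

lemma openProb_add_closedProb (hp0 : 0 ≤ p) (hp1 : p ≤ 1) (hq : 0 < q) (e : Edge m)
    (ω : Config m) : openProb S p q e ω + closedProb S p q e ω = 1 := by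
  have h1 : 0 ≤ 1 - p := by linarith
  have h2 : p ≤ p + q * (1 - p) := le_add_of_nonneg_right (by positivity)
  have h3 : 0 ≤ p + q * (1 - p) := hp0.trans h2
  have h4 : p / (p + q * (1 - p)) ≤ 1 := div_le_one_of_le₀ h2 h3
  rw [openProb, closedProb]
  split_ifs
  · rw [← ENNReal.ofReal_add hp0 h1]; simp
  · rw [← ENNReal.ofReal_add (by positivity) (by linarith)]; simp

lemma setLIntegral_of_outSigmaE {e : Edge m} {J : Set (Config m)} {k : Config m → ℝ≥0∞}
    (hk : Measurable k)
    (h : ∀ B, MeasurableSet[outSigmaE e] B → φ (J ∩ B) = ∫⁻ ξ in B, k ξ ∂φ)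
    {g : Config m → ℝ≥0∞} (hg : Measurable[outSigmaE e] g) :
    ∫⁻ ω in J, g ω ∂φ = ∫⁻ ω, k ω * g ω ∂φ := by
  have hle := outSigmaE_le e
  have : (φ.restrict J).trim hle = (φ.withDensity k).trim hle := by
    refine @Measure.ext _ (outSigmaE e) _ _ fun B hB => ?_
    rw [trim_measurableSet_eq hle hB, trim_measurableSet_eq hle hB,
      Measure.restrict_apply (hle B hB), withDensity_apply _ (hle B hB), Set.inter_comm, h B hB]
  rw [← lintegral_trim hle hg, this, lintegral_trim hle hg,
    lintegral_withDensity_eq_lintegral_mul _ hk (hg.mono hle le_rfl)]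
  rfl

variable [IsProbabilityMeasure φ]

lemma SingleEdge.measure_compl (hS : MeasRel S) (hp0 : 0 ≤ p) (hp1 : p ≤ 1) (hq : 0 < q)
    (hφ : SingleEdge S p q φ) (e : Edge m) {B : Set (Config m)}
    (hB : MeasurableSet[outSigmaE e] B) :
    φ ((JEdge e)ᶜ ∩ B) = ∫⁻ ξ in B, closedProb S p q e ξ ∂φ := by
  have h1 : φ (JEdge e ∩ B) + φ ((JEdge e)ᶜ ∩ B) = φ B := by
    rw [Set.inter_comm, Set.inter_comm _ B, ← Set.sdiff_eq]
    exact measure_inter_add_sdiff B (measurableSet_jEdge e)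
  have h2 : φ (JEdge e ∩ B) + ∫⁻ ξ in B, closedProb S p q e ξ ∂φ = φ B := by
    rw [hφ e B hB, ← lintegral_add_left (measurable_openProb hS p q e)]
    simp [openProb_add_closedProb hp0 hp1 hq]
  exact (ENNReal.add_right_inj (measure_ne_top φ _)).1 (h1.trans h2.symm)

/-- Opening an edge changes the measure by the conditional odds. -/
lemma SingleEdge.flip (hS : MeasRel S) (hp0 : 0 < p) (hp1 : p < 1) (hq : 0 < q)
    (hφ : SingleEdge S p q φ) (e : Edge m) {g : Config m → ℝ≥0∞} (hg : Measurable g) :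
    ∫⁻ ω in JEdge e, g ω ∂φ = ∫⁻ ω in (JEdge e)ᶜ, odds S p q e ω * g (openE e ω) ∂φ := by
  have h1 : Measurable[outSigmaE e] fun ω => g (openE e ω) :=
    measurable_comap_restrict (hg.comp (measurable_openE e)) fun ω ω' h => by
      rw [openE_congr h]
  have h2 : Measurable[outSigmaE e] fun ω => odds S p q e ω * g (openE e ω) :=
    @Measurable.mul _ _ _ _ (outSigmaE e) (odds S p q e) (fun ω => g (openE e ω)) _
      (measurable_odds_outSigmaE hS p q e) h1
  calc ∫⁻ ω in JEdge e, g ω ∂φ = ∫⁻ ω in JEdge e, g (openE e ω) ∂φ :=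
        setLIntegral_congr_fun (measurableSet_jEdge e) fun ω h => by
          simp only [openE_of_open (show ω e = true from h)]
    _ = ∫⁻ ω, openProb S p q e ω * g (openE e ω) ∂φ :=
        setLIntegral_of_outSigmaE (measurable_openProb hS p q e) (hφ e) h1
    _ = ∫⁻ ω, closedProb S p q e ω * (odds S p q e ω * g (openE e ω)) ∂φ := by
        simp_rw [← mul_assoc, closedProb_mul_odds hp0 hp1 hq]
    _ = _ := (setLIntegral_of_outSigmaE (measurable_closedProb hS p q e)
        (fun B hB => hφ.measure_compl hS hp0.le hp1.le hq e hB) h2).symm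

end

/-! ### Consistency of typical configurations -/

lemma closeE_of_mem_compl {e : Edge m} {ω : Config m} (h : ω ∈ (JEdge e)ᶜ) : closeE e ω = ω :=
  closeE_of_closed (by simpa [JEdge] using h)

section

variable {p q : ℝ} {φ : Measure (Config m)} [IsProbabilityMeasure φ]

lemma SingleEdge.ae_openE (hS : MeasRel S) (hp0 : 0 < p) (hp1 : p < 1) (hq : 0 < q)
    (hφ : SingleEdge S p q φ) (e : Edge m) {P : Config m → Prop} (h : ∀ᵐ ω ∂φ, P ω) :
    ∀ᵐ ω ∂φ, P (openE e ω) := by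
  obtain ⟨N, hPN, hN, hN0⟩ := exists_measurable_superset_of_null (ae_iff.1 h)
  have hg : Measurable (N.indicator (1 : Config m → ℝ≥0∞)) := measurable_one.indicator hN
  have hg' : Measurable fun ω => odds S p q e ω * N.indicator (1 : Config m → ℝ≥0∞) (openE e ω) :=
    (measurable_odds hS p q e).mul (hg.comp (measurable_openE e))
  have h0 := hφ.flip hS hp0 hp1 hq e hg
  rw [lintegral_indicator_one hN, Measure.restrict_apply hN,
    measure_mono_null Set.inter_subset_left hN0, eq_comm, lintegral_eq_zero_iff hg',
    Filter.EventuallyEq,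
    ae_restrict_iff' (measurableSet_jEdge e).compl] at h0
  filter_upwards [h0, h] with ω h1 h2
  by_cases hω : ω ∈ JEdge e
  · rwa [openE_of_open hω]
  · by_contra h3
    have h4 : openE e ω ∈ N := hPN h3
    have h5 := h1 hω
    simp [h4, odds_ne_zero hp0 hp1 hq] at h5

lemma SingleEdge.ae_closeE (hS : MeasRel S) (hp0 : 0 < p) (hp1 : p < 1) (hq : 0 < q)
    (hφ : SingleEdge S p q φ) (e : Edge m) {P : Config m → Prop} (h : ∀ᵐ ω ∂φ, P ω) :
    ∀ᵐ ω ∂φ, P (closeE e ω) := by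
  obtain ⟨N, hPN, hN, hN0⟩ := exists_measurable_superset_of_null (ae_iff.1 h)
  have hg : Measurable fun ω => N.indicator (1 : Config m → ℝ≥0∞) (closeE e ω) :=
    (measurable_one.indicator hN).comp (measurable_closeE e)
  have h0 := hφ.flip hS hp0 hp1 hq e hg
  have h1 : ∫⁻ ω in (JEdge e)ᶜ, odds S p q e ω *
      N.indicator (1 : Config m → ℝ≥0∞) (closeE e (openE e ω)) ∂φ = 0 := by
    refine lintegral_eq_zero_of_ae_eq_zero ?_
    rw [Filter.EventuallyEq, ae_restrict_iff' (measurableSet_jEdge e).compl]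
    filter_upwards [measure_eq_zero_iff_ae_notMem.1 hN0] with ω hω hωe
    simp [closeE_of_mem_compl hωe, hω]
  rw [h1, lintegral_eq_zero_iff hg, Filter.EventuallyEq,
    ae_restrict_iff' (measurableSet_jEdge e)] at h0
  filter_upwards [h0, h] with ω h1 h2
  by_cases hω : ω ∈ JEdge e
  · by_contra h3
    have h4 : closeE e ω ∈ N := hPN h3
    have h5 := h1 hω
    simp [h4] at h5
  · rwa [closeE_of_mem_compl hω]

lemma setCfg_empty (F : Finset (Edge m)) (ω : Config m) : setCfg ∅ F ω = ω := by
  ext; simp [setCfg]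

lemma setCfg_insert {E F : Finset (Edge m)} {e : Edge m} (ω : Config m) :
    setCfg (insert e E) F ω =
      if e ∈ F then openE e (setCfg E F ω) else closeE e (setCfg E F ω) := by
  ext f
  by_cases hf : f = e
  · subst hf
    split_ifs with h <;> simp [setCfg, h]
  · split_ifs with h <;> simp [openE_apply_of_ne hf, closeE_apply_of_ne hf, setCfg, hf]

lemma SingleEdge.ae_setCfg (hS : MeasRel S) (hp0 : 0 < p) (hp1 : p < 1) (hq : 0 < q)
    (hφ : SingleEdge S p q φ) (E F : Finset (Edge m)) {P : Config m → Prop}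
    (h : ∀ᵐ ω ∂φ, P ω) : ∀ᵐ ω ∂φ, P (setCfg E F ω) := by
  induction E using Finset.induction_on generalizing P with
  | empty => simpa only [setCfg_empty] using h
  | insert e E _ ih =>
    simp only [setCfg_insert]
    split_ifs
    · exact ih (hφ.ae_openE hS hp0 hp1 hq e h)
    · exact ih (hφ.ae_closeE hS hp0 hp1 hq e h)

lemma SingleEdge.double_flip (hS : MeasRel S) (hp0 : 0 < p) (hp1 : p < 1) (hq : 0 < q)
    (hφ : SingleEdge S p q φ) {e f : Edge m} (hef : e ≠ f) {g : Config m → ℝ≥0∞}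
    (hg : Measurable g) :
    ∫⁻ ω in JEdge e ∩ JEdge f, g ω ∂φ = ∫⁻ ω in (JEdge e)ᶜ ∩ (JEdge f)ᶜ,
      odds S p q f ω * (odds S p q e (openE f ω) * g (openE e (openE f ω))) ∂φ := by
  have he := measurableSet_jEdge e
  have hf := measurableSet_jEdge f
  have h1 : Measurable fun ω => odds S p q e ω * g (openE e ω) :=
    (measurable_odds hS p q e).mul (hg.comp (measurable_openE e))
  rw [Set.inter_comm, ← setLIntegral_indicator hf, hφ.flip hS hp0 hp1 hq e (hg.indicator hf)]
  have h2 : ∀ ω, odds S p q e ω * (JEdge f).indicator g (openE e ω) =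
      (JEdge f).indicator (fun ω => odds S p q e ω * g (openE e ω)) ω := by
    intro ω
    have : openE e ω ∈ JEdge f ↔ ω ∈ JEdge f := by simp [JEdge, openE_apply_of_ne hef.symm]
    by_cases h : ω ∈ JEdge f <;> simp [h, this]
  simp_rw [h2]
  rw [setLIntegral_indicator hf, Set.inter_comm, ← setLIntegral_indicator he.compl,
    hφ.flip hS hp0 hp1 hq f (h1.indicator he.compl), ← setLIntegral_indicator he.compl]
  refine lintegral_congr fun ω => ?_
  have : openE f ω ∈ JEdge e ↔ ω ∈ JEdge e := by simp [JEdge, openE_apply_of_ne hef]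
  by_cases h : ω ∈ JEdge e <;> simp [h, this]

lemma SingleEdge.ae_odds_comm (hS : MeasRel S) (hp0 : 0 < p) (hp1 : p < 1) (hq : 0 < q)
    (hφ : SingleEdge S p q φ) {e f : Edge m} (hef : e ≠ f) :
    ∀ᵐ ω ∂φ, ω e = false → ω f = false →
      odds S p q f ω * odds S p q e (openE f ω) = odds S p q e ω * odds S p q f (openE e ω) := by
  have he := (measurableSet_jEdge e).compl
  have hf := (measurableSet_jEdge f).compl
  have hm : ∀ a b : Edge m, Measurable fun ω => odds S p q a ω * odds S p q b (openE a ω) :=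
    fun a b => (measurable_odds hS p q a).mul ((measurable_odds hS p q b).comp (measurable_openE a))
  have key : ∀ a b : Edge m, a ≠ b → ∀ A : Set (Config m), MeasurableSet A →
      ∫⁻ ω in JEdge a ∩ JEdge b, A.indicator 1 (closeE a (closeE b ω)) ∂φ =
        ∫⁻ ω in (JEdge a)ᶜ ∩ (JEdge b)ᶜ, A.indicator
          (fun ω => odds S p q b ω * odds S p q a (openE b ω)) ω ∂φ := by
    intro a b hab A hA
    have hg : Measurable fun ω => A.indicator (1 : Config m → ℝ≥0∞) (closeE a (closeE b ω)) :=
      (measurable_one.indicator hA).comp ((measurable_closeE a).comp (measurable_closeE b))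
    rw [hφ.double_flip hS hp0 hp1 hq hab hg]
    refine setLIntegral_congr_fun
      ((measurableSet_jEdge a).compl.inter (measurableSet_jEdge b).compl) fun ω hω => ?_
    have : closeE a (closeE b (openE a (openE b ω))) = ω := by
      rw [openE_comm, closeE_openE]
      ext g
      have h1 : ω a = false := by simpa [JEdge] using hω.1
      have h2 : ω b = false := by simpa [JEdge] using hω.2
      by_cases hga : g = a
      · subst hga; simp [h1]
      by_cases hgb : g = b
      · subst hgb; simp [closeE, openE, hga, h2]
      · simp [closeE, openE, hga, hgb]
    by_cases h : ω ∈ A <;> simp [this, h]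
  have h := ae_eq_of_forall_setLIntegral_eq_of_sigmaFinite
    (μ := φ.restrict ((JEdge e)ᶜ ∩ (JEdge f)ᶜ)) (hm f e) (hm e f) fun A hA _ => by
      rw [← lintegral_indicator hA, ← lintegral_indicator hA, ← key e f hef A hA, Set.inter_comm,
        Set.inter_comm (JEdge e)ᶜ, ← key f e hef.symm A hA]
      refine lintegral_congr fun ω => ?_
      congr 1
      ext g
      simp only [closeE, Function.update_apply]
      split_ifs <;> rfl
  rw [Filter.EventuallyEq, ae_restrict_iff' (he.inter hf)] at h
  filter_upwards [h] with ω h h1 h2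
  exact h ⟨by simp [JEdge, h1], by simp [JEdge, h2]⟩

lemma SingleEdge.ae_squareConsistent (hS : MeasRel S) (hp0 : 0 < p) (hp1 : p < 1) (hq : 0 < q)
    (hq1 : q ≠ 1) (hφ : SingleEdge S p q φ) : ∀ᵐ ω ∂φ, SquareConsistent S ω := by
  have h : ∀ᵐ ω ∂φ, ∀ e f : Edge m, e ≠ f → ω e = false → ω f = false →
      odds S p q f ω * odds S p q e (openE f ω) = odds S p q e ω * odds S p q f (openE e ω) := by
    rw [ae_all_iff]; intro e
    rw [ae_all_iff]; intro f
    by_cases hef : e = f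
    · simp [hef]
    · filter_upwards [hφ.ae_odds_comm hS hp0 hp1 hq hef] with ω h _ using h
  filter_upwards [h] with ω h e f hef he hf h1 h2
  by_contra h3
  have h4 := h e f hef he hf
  have h5 : 0 < 1 - p := by linarith
  simp only [odds, h1, h2, h3, if_true, if_false] at h4
  split_ifs at h4 <;>
  · rw [← ENNReal.ofReal_mul (by positivity), ← ENNReal.ofReal_mul (by positivity),
      ENNReal.ofReal_eq_ofReal_iff (by positivity) (by positivity)] at h4
    field_simp at h4
    exact hq1 (by nlinarith)

lemma SingleEdge.ae_consistent (hS : MeasRel S) (hp0 : 0 < p) (hp1 : p < 1) (hq : 0 < q)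
    (hq1 : q ≠ 1) (hφ : SingleEdge S p q φ) : ∀ᵐ ω ∂φ, Consistent S ω := by
  have h : ∀ᵐ ω ∂φ, ∀ E F : Finset (Edge m), SquareConsistent S (setCfg E F ω) := by
    rw [ae_all_iff]; intro E
    rw [ae_all_iff]; intro F
    exact hφ.ae_setCfg hS hp0 hp1 hq E F (hφ.ae_squareConsistent hS hp0 hp1 hq hq1)
  filter_upwards [h] with ω h ω' hfin
  convert h hfin.toFinset (hfin.toFinset.filter fun e => ω' e = true) using 1
  ext e
  by_cases he : ω' e = ω e
  · simp [setCfg, he]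
  · simp [setCfg, he]

end

/-! ### From single edges to finite volumes -/

section

variable {p q : ℝ}

lemma rcWeight_openE (hequiv : Equivalence S) (hp0 : 0 < p) (hp1 : p < 1) (hq : 0 < q)
    {Λ : Finset (V m)} {e : Edge m} (he : e ∈ EdgeFinset Λ) {ω : Config m}
    (hω : q = 1 ∨ Consistent S ω) :
    rcWeight S p q Λ (openE e ω) = odds S p q e ω * rcWeight S p q Λ (closeE e ω) := by
  obtain ⟨R, h1, h2⟩ := rcWeight_split (S := S) p q he ω
  have h3 : 0 < 1 - p := by linarith
  have h4 : ENNReal.ofReal (p / (1 - p)) * ENNReal.ofReal (1 - p) = ENNReal.ofReal p := by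
    rw [← ENNReal.ofReal_mul (by positivity)]; congr 1; field_simp
  have h5 : ENNReal.ofReal (p / ((1 - p) * q)) * (ENNReal.ofReal (1 - p) * ENNReal.ofReal q) =
      ENNReal.ofReal p := by
    rw [← ENNReal.ofReal_mul h3.le, ← ENNReal.ofReal_mul (by positivity)]; congr 1; field_simp
  rw [h1, h2, odds]
  split_ifs with hK
  · rw [kCount_openE_of_mem hequiv (mem_edgeFinset.1 he) hK, ← h4]
    ring
  · rcases hω with rfl | hω
    · simp only [ENNReal.ofReal_one, mul_one, one_pow] at h5 ⊢
      rw [← h5]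
      ring
    · rw [kCount_closeE_of_notMem hequiv hω (mem_edgeFinset.1 he) hK, ← h5]
      ring

/-- The event that the open edges in `E` are exactly those in `F`. -/
def patternEvent (E F : Finset (Edge m)) : Set (Config m) := {ω | setCfg E F ω = ω}

lemma measurableSet_patternEvent (E F : Finset (Edge m)) :
    MeasurableSet (patternEvent E F : Set (Config m)) :=
  measurableSet_eq_fun (measurable_setCfg E F) measurable_id

lemma mem_patternEvent {E F : Finset (Edge m)} {ω : Config m} :
    ω ∈ patternEvent E F ↔ ∀ e ∈ E, (ω e = true ↔ e ∈ F) := by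
  constructor
  · intro h e he
    rw [← congrFun h e]
    simp [setCfg, he]
  · intro h
    ext e
    by_cases he : e ∈ E
    · rw [setCfg, if_pos he, Bool.decide_congr (h e he).symm, Bool.decide_eq_true]
    · exact setCfg_of_notMem he

lemma openE_setCfg {E F : Finset (Edge m)} {e : Edge m} (he : e ∈ E) (ω : Config m) :
    openE e (setCfg E F ω) = setCfg E (insert e F) ω := by
  ext f
  by_cases hf : f = e
  · subst hf; simp [setCfg, he]
  · simp [openE_apply_of_ne hf, setCfg, hf]

variable {φ : Measure (Config m)} [IsProbabilityMeasure φ]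

lemma SingleEdge.setLIntegral_patternEvent (hequiv : Equivalence S) (hS : MeasRel S) (hp0 : 0 < p)
    (hp1 : p < 1) (hq : 0 < q) (hφ : SingleEdge S p q φ) (Λ : Finset (V m))
    {F : Finset (Edge m)} (hF : F ⊆ EdgeFinset Λ) {g : Config m → ℝ≥0∞} (hg : Measurable g) :
    ∫⁻ ω in patternEvent (EdgeFinset Λ) F, g ω ∂φ =
      ∫⁻ ω in patternEvent (EdgeFinset Λ) ∅, g (setCfg (EdgeFinset Λ) F ω) *
        (rcWeight S p q Λ (setCfg (EdgeFinset Λ) F ω) / rcWeight S p q Λ ω) ∂φ := by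
  have hh := measurable_rcWeight hS p q Λ
  have hgood : ∀ᵐ ω ∂φ, q = 1 ∨ Consistent S ω := by
    by_cases hq1 : q = 1
    · simp [hq1]
    · filter_upwards [hφ.ae_consistent hS hp0 hp1 hq hq1] with ω h using Or.inr h
  set E := EdgeFinset Λ with hE
  have hne : ∀ ω, rcWeight S p q Λ ω ≠ 0 := rcWeight_ne_zero hp0 hp1 hq Λ
  have hnt : ∀ ω, rcWeight S p q Λ ω ≠ ⊤ := rcWeight_ne_top p q Λ
  induction F using Finset.induction_on generalizing g with
  | empty =>
    refine setLIntegral_congr_fun (measurableSet_patternEvent E ∅) fun ω hω => ?_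
    rw [show setCfg E ∅ ω = ω from hω]
    simp only [ENNReal.div_self (hne ω) (hnt ω), mul_one]
  | insert e F heF ih =>
    have heE : e ∈ E := hF (Finset.mem_insert_self e F)
    have hsub : patternEvent E (insert e F) ⊆ JEdge e := fun ω hω =>
      (mem_patternEvent.1 hω e heE).2 (Finset.mem_insert_self e F)
    have hm := measurableSet_patternEvent (m := m) E (insert e F)
    have hiff : ∀ ω ∈ (JEdge e)ᶜ, openE e ω ∈ patternEvent E (insert e F) ↔
        ω ∈ patternEvent E F := by
      intro ω hω
      simp only [mem_patternEvent]
      refine forall₂_congr fun f _ => ?_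
      by_cases hfe : f = e
      · subst hfe
        have : ω f = false := by simpa [JEdge] using hω
        simp [this, heF]
      · simp [openE_apply_of_ne hfe, hfe]
    have hsub' : patternEvent E F ⊆ (JEdge e)ᶜ := fun ω hω h =>
      heF ((mem_patternEvent.1 hω e heE).1 h)
    calc ∫⁻ ω in patternEvent E (insert e F), g ω ∂φ
        = ∫⁻ ω in JEdge e, (patternEvent E (insert e F)).indicator g ω ∂φ := by
          rw [setLIntegral_indicator hm, Set.inter_eq_left.2 hsub]
      _ = ∫⁻ ω in (JEdge e)ᶜ, (patternEvent E F).indicator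
            (fun ω => odds S p q e ω * g (openE e ω)) ω ∂φ := by
          rw [hφ.flip hS hp0 hp1 hq e (hg.indicator hm)]
          refine setLIntegral_congr_fun (measurableSet_jEdge e).compl fun ω hω => ?_
          have := hiff ω hω
          by_cases h : ω ∈ patternEvent E F
          · simp [h, this.2 h]
          · simp [h, mt this.1 h]
      _ = ∫⁻ ω in patternEvent E F, odds S p q e ω * g (openE e ω) ∂φ := by
          rw [setLIntegral_indicator (measurableSet_patternEvent E F), Set.inter_eq_left.2 hsub']
      _ = ∫⁻ ω in patternEvent E F, rcWeight S p q Λ (openE e ω) / rcWeight S p q Λ ω *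
            g (openE e ω) ∂φ := by
          refine setLIntegral_congr_fun_ae (measurableSet_patternEvent E F) ?_
          filter_upwards [hgood] with ω hω hωF
          rw [rcWeight_openE hequiv hp0 hp1 hq heE hω, closeE_of_mem_compl (hsub' hωF),
            ENNReal.mul_div_cancel_right (hne ω) (hnt ω)]
      _ = _ := by
          have hmeas : Measurable fun ω => rcWeight S p q Λ (openE e ω) / rcWeight S p q Λ ω *
              g (openE e ω) :=
            ((hh.comp (measurable_openE e)).div hh).mul (hg.comp (measurable_openE e))
          rw [ih hmeas ((Finset.subset_insert e F).trans hF)]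
          refine lintegral_congr fun ω => ?_
          rw [openE_setCfg heE, mul_comm (_ / _) (g _), mul_assoc]
          congr 1
          rw [div_eq_mul_inv, div_eq_mul_inv, div_eq_mul_inv, mul_assoc,
            ← mul_assoc _ _ (rcWeight S p q Λ ω)⁻¹,
            ENNReal.inv_mul_cancel (hne _) (hnt _), one_mul]

lemma SingleEdge.lintegral_eq (hequiv : Equivalence S) (hS : MeasRel S) (hp0 : 0 < p)
    (hp1 : p < 1) (hq : 0 < q) (hφ : SingleEdge S p q φ) (Λ : Finset (V m))
    {g : Config m → ℝ≥0∞} (hg : Measurable g) :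
    ∫⁻ ω, g ω ∂φ = ∫⁻ ω in patternEvent (EdgeFinset Λ) ∅, (∑ F ∈ (EdgeFinset Λ).powerset,
      g (setCfg (EdgeFinset Λ) F ω) * rcWeight S p q Λ (setCfg (EdgeFinset Λ) F ω)) *
        (rcWeight S p q Λ ω)⁻¹ ∂φ := by
  set E := EdgeFinset Λ with hE
  have hh := measurable_rcWeight hS p q Λ
  have h1 : ∀ ω, g ω = ∑ F ∈ E.powerset, (patternEvent E F).indicator g ω := by
    intro ω
    rw [Finset.sum_eq_single (E.filter fun e => ω e = true)]
    · rw [Set.indicator_of_mem]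
      refine mem_patternEvent.2 fun e he => ?_
      simp [he]
    · intro F hF hne
      refine Set.indicator_of_notMem (fun hω => hne ?_) _
      ext e
      have := mem_patternEvent.1 hω e
      have h2 : e ∈ F → e ∈ E := fun h => Finset.mem_powerset.1 hF h
      simp only [Finset.mem_filter]
      tauto
    · simp
  rw [lintegral_congr h1, lintegral_finsetSum _ fun F _ =>
    hg.indicator (measurableSet_patternEvent E F)]
  simp_rw [Finset.sum_mul, mul_assoc, ← div_eq_mul_inv]
  have h2 : ∀ F ∈ E.powerset, Measurable fun ω => g (setCfg E F ω) *
      (rcWeight S p q Λ (setCfg E F ω) / rcWeight S p q Λ ω) := fun F _ =>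
    (hg.comp (measurable_setCfg E F)).mul ((hh.comp (measurable_setCfg E F)).div hh)
  rw [lintegral_finsetSum _ h2]
  refine Finset.sum_congr rfl fun F hF => ?_
  rw [lintegral_indicator (measurableSet_patternEvent E F),
    hφ.setLIntegral_patternEvent hequiv hS hp0 hp1 hq Λ (Finset.mem_powerset.1 hF) hg]

lemma mem_setCfg_iff {Λ : Finset (V m)} {B : Set (Config m)} (hB : MeasurableSet[outSigma Λ] B)
    (F : Finset (Edge m)) (ω : Config m) : setCfg (EdgeFinset Λ) F ω ∈ B ↔ ω ∈ B :=
  mem_iff_of_measurableSet_comap hB fun _ he => setCfg_of_notMem he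

lemma SingleEdge.measure_inter (hequiv : Equivalence S) (hS : MeasRel S) (hp0 : 0 < p)
    (hp1 : p < 1) (hq : 0 < q) (hφ : SingleEdge S p q φ) (Λ : Finset (V m))
    {A B : Set (Config m)} (hA : MeasurableSet A) (hB : MeasurableSet[outSigma Λ] B) :
    φ (A ∩ B) = ∫⁻ ξ in B, rcFin S p q Λ ξ A ∂φ := by
  have hB' := outSigma_le Λ B hB
  have hh := measurable_rcWeight hS p q Λ
  set E := EdgeFinset Λ with hE
  let Z : Config m → ℝ≥0∞ := fun ω => ∑ F ∈ E.powerset, rcWeight S p q Λ (setCfg E F ω)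
  let N : Config m → ℝ≥0∞ := fun ω => ∑ F ∈ E.powerset, rcWeight S p q Λ (setCfg E F ω) *
    A.indicator 1 (setCfg E F ω)
  have hZm : Measurable Z := Finset.measurable_sum _ fun F _ => hh.comp (measurable_setCfg E F)
  have hNm : Measurable N := Finset.measurable_sum _ fun F _ =>
    (hh.comp (measurable_setCfg E F)).mul
      ((measurable_one.indicator hA).comp (measurable_setCfg E F))
  have hZ0 : ∀ ω, Z ω ≠ 0 := fun ω h =>
    rcWeight_ne_zero hp0 hp1 hq Λ _ (Finset.sum_eq_zero_iff.1 h ∅ (by simp))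
  have hZt : ∀ ω, Z ω ≠ ⊤ := fun ω => ENNReal.sum_ne_top.2 fun F _ => rcWeight_ne_top p q Λ _
  have hG : Measurable (B.indicator fun ω => (Z ω)⁻¹ * N ω) := (hZm.inv.mul hNm).indicator hB'
  simp_rw [rcFin_apply p q Λ _ hA]
  rw [← lintegral_indicator hB', ← lintegral_indicator_one (hA.inter hB'),
    hφ.lintegral_eq hequiv hS hp0 hp1 hq Λ hG,
    hφ.lintegral_eq hequiv hS hp0 hp1 hq Λ (measurable_one.indicator (hA.inter hB')), ← hE]
  refine lintegral_congr fun ω => ?_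
  congr 1
  have hBi : ∀ F, setCfg E F ω ∈ B ↔ ω ∈ B := fun F => mem_setCfg_iff hB F ω
  by_cases hω : ω ∈ B
  · have h1 : ∀ F, (B.indicator fun ω => (Z ω)⁻¹ * N ω) (setCfg E F ω) = (Z ω)⁻¹ * N ω := by
      intro F
      rw [Set.indicator_of_mem ((hBi F).2 hω)]
      simp only [Z, N, setCfg_setCfg]
    have h2 : ∀ F, (A ∩ B).indicator (1 : Config m → ℝ≥0∞) (setCfg E F ω) =
        A.indicator 1 (setCfg E F ω) := by
      intro F
      have := (hBi F).2 hω
      by_cases h : setCfg E F ω ∈ A <;> simp [h, this]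
    simp_rw [h1, h2, ← Finset.mul_sum]
    change _ = (Z ω)⁻¹ * N ω * Z ω
    rw [mul_right_comm, ENNReal.inv_mul_cancel (hZ0 ω) (hZt ω), one_mul]
    exact Finset.sum_congr rfl fun F _ => mul_comm _ _
  · have h1 : ∀ F, setCfg E F ω ∉ B := fun F => mt (hBi F).1 hω
    simp [h1]

end

/-! ### The two directions of the characterisation -/

lemma setCfg_singleton_empty (e : Edge m) (ω : Config m) : setCfg {e} ∅ ω = closeE e ω := by
  ext f
  by_cases hf : f = e
  · subst hf; simp [setCfg]
  · simp [setCfg, hf, closeE_apply_of_ne hf]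

lemma setCfg_singleton_self (e : Edge m) (ω : Config m) : setCfg {e} {e} ω = openE e ω := by
  ext f
  by_cases hf : f = e
  · subst hf; simp [setCfg]
  · simp [setCfg, hf, openE_apply_of_ne hf]

lemma rcWeight_pair (p q : ℝ) (e : Edge m) (ω : Config m) :
    rcWeight S p q {parentV e, childV e} ω = ENNReal.ofReal (if ω e then p else 1 - p) *
      ENNReal.ofReal q ^ kCount S {parentV e, childV e} ω := by
  rw [rcWeight, edgeFinset_pair, Finset.prod_singleton]

section

variable {p q : ℝ} {φ : Measure (Config m)}

lemma rcFin_pair_jEdge (hequiv : Equivalence S) (hp0 : 0 ≤ p) (hp1 : p ≤ 1) (hq : 0 < q)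
    (e : Edge m) (ξ : Config m) :
    rcFin S p q {parentV e, childV e} ξ (JEdge e) = openProb S p q e ξ := by
  have h1 : 0 ≤ 1 - p := by linarith
  have h2 : 0 < p + q * (1 - p) := by
    rcases hp0.eq_or_lt with rfl | h
    · simpa using hq
    · positivity
  have hQ0 : ∀ k : ℕ, ENNReal.ofReal q ^ k ≠ 0 := fun k =>
    pow_ne_zero k (by rwa [ne_eq, ENNReal.ofReal_eq_zero, not_le])
  have hQt : ∀ k : ℕ, ENNReal.ofReal q ^ k ≠ ⊤ := fun k => ENNReal.pow_ne_top ENNReal.ofReal_ne_top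
  have he : e ∈ ELam (↑({parentV e, childV e} : Finset (V m)) : Set (V m)) :=
    mem_edgeFinset.1 (by simp [edgeFinset_pair])
  have hJ1 : openE e ξ ∈ JEdge e := openE_apply_self e ξ
  have hJ2 : closeE e ξ ∉ JEdge e := by simp [JEdge]
  rw [rcFin_apply p q _ ξ (measurableSet_jEdge e), edgeFinset_pair,
    show ({e} : Finset (Edge m)).powerset = {∅, {e}} from rfl,
    Finset.sum_pair (Finset.singleton_ne_empty e).symm,
    Finset.sum_pair (Finset.singleton_ne_empty e).symm, setCfg_singleton_empty,
    setCfg_singleton_self, Set.indicator_of_mem hJ1, Set.indicator_of_notMem hJ2, mul_zero,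
    zero_add, Pi.one_apply, mul_one, rcWeight_pair, rcWeight_pair, openE_apply_self,
    closeE_apply_self, openProb, mul_comm _⁻¹, ← div_eq_mul_inv]
  simp only [if_true, Bool.false_eq_true, if_false]
  split_ifs with hK
  · rw [kCount_openE_of_mem hequiv he hK, ← add_mul, ENNReal.mul_div_mul_right _ _ (hQ0 _) (hQt _),
      ← ENNReal.ofReal_add h1 hp0]
    simp
  · rw [kCount_pair_closeE_of_notMem hequiv hK, pow_succ', ← mul_assoc, ← add_mul,
      ENNReal.mul_div_mul_right _ _ (hQ0 _) (hQt _), ← ENNReal.ofReal_mul h1,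
      ← ENNReal.ofReal_add (by positivity) hp0, ← ENNReal.ofReal_div_of_pos (by linarith)]
    congr 2
    ring

lemma singleEdge_of_mem_rcSet (hequiv : Equivalence S) (hp0 : 0 ≤ p) (hp1 : p ≤ 1) (hq : 0 < q)
    (hφ : φ ∈ RCSet S p q) : SingleEdge S p q φ := by
  intro e B hB
  have hB' : MeasurableSet[outSigma {parentV e, childV e}] B :=
    measurableSet_comap_restrict (outSigmaE_le e B hB) fun ω ω' h =>
      mem_iff_of_measurableSet_comap hB fun f hf => h f (by simpa [edgeFinset_pair] using hf)
  rw [hφ.2 _ _ (measurableSet_jEdge e) B hB']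
  simp_rw [rcFin_pair_jEdge hequiv hp0 hp1 hq]

lemma rcFin_const (hp : p = 0 ∨ p = 1) (hq : 0 < q) (Λ : Finset (V m)) {A : Set (Config m)}
    (hA : MeasurableSet A) :
    rcFin S p q Λ (fun _ => decide (p = 1)) A = A.indicator 1 fun _ => decide (p = 1) := by
  let c : Config m := fun _ => decide (p = 1)
  let F₀ := (EdgeFinset Λ).filter fun e => c e = true
  have hF₀ : setCfg (EdgeFinset Λ) F₀ c = c := mem_patternEvent.2 fun e he => by simp [F₀, he]
  have hc0 : rcWeight S p q Λ c ≠ 0 := by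
    refine mul_ne_zero (Finset.prod_ne_zero_iff.2 fun e _ => ?_) (pow_ne_zero _ ?_)
    · rcases hp with rfl | rfl <;> simp [c]
    · rwa [ne_eq, ENNReal.ofReal_eq_zero, not_le]
  have hw : ∀ F ∈ (EdgeFinset Λ).powerset, F ≠ F₀ →
      rcWeight S p q Λ (setCfg (EdgeFinset Λ) F c) = 0 := by
    intro F hF hne
    have : ∃ e ∈ EdgeFinset Λ, ¬(e ∈ F ↔ e ∈ F₀) := by
      by_contra! h
      refine hne (Finset.ext fun e => ?_)
      by_cases he : e ∈ EdgeFinset Λ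
      · exact h e he
      · exact iff_of_false (fun h' => he (Finset.mem_powerset.1 hF h'))
          fun h' => he (Finset.mem_filter.1 h').1
    obtain ⟨e, he, hne⟩ := this
    refine mul_eq_zero_of_left (Finset.prod_eq_zero he ?_) _
    have hne' : ¬(e ∈ F ↔ p = 1) := by
      simpa only [F₀, Finset.mem_filter, he, true_and, c, decide_eq_true_eq] using hne
    rcases hp with rfl | rfl
    · have : e ∈ F := by simpa using hne'
      simp [setCfg, he, this]
    · have : e ∉ F := by simpa using hne'
      simp [setCfg, he, this]
  have hmem : F₀ ∈ (EdgeFinset Λ).powerset := Finset.mem_powerset.2 (Finset.filter_subset _ _)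
  rw [rcFin_apply p q Λ _ hA, Finset.sum_eq_single_of_mem F₀ hmem hw,
    Finset.sum_eq_single_of_mem F₀ hmem fun F hF hne => by rw [hw F hF hne, zero_mul], hF₀,
    ← mul_assoc, ENNReal.inv_mul_cancel hc0 (rcWeight_ne_top p q Λ c), one_mul]

variable [IsProbabilityMeasure φ]

lemma SingleEdge.eq_dirac (hp : p = 0 ∨ p = 1) (hφ : SingleEdge S p q φ) :
    φ = Measure.dirac fun _ => decide (p = 1) := by
  have h : ∀ᵐ ω ∂φ, ω = fun _ => decide (p = 1) := by
    have : ∀ᵐ ω ∂φ, ∀ e : Edge m, ω e = decide (p = 1) := by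
      refine ae_all_iff.2 fun e => ?_
      have h := hφ e Set.univ .univ
      rw [Set.inter_univ, Measure.restrict_univ] at h
      rcases hp with rfl | rfl
      · have h0 : φ (JEdge e) = 0 := by simpa [openProb] using h
        filter_upwards [measure_eq_zero_iff_ae_notMem.1 h0] with ω hω
        simpa [JEdge] using hω
      · have h1 : φ (JEdge e) = 1 := by simpa [openProb] using h
        filter_upwards [(mem_ae_iff_prob_eq_one (measurableSet_jEdge e)).2 h1] with ω hω
        simpa [JEdge] using hω
    filter_upwards [this] with ω hω using funext hω
  calc φ = φ.map id := Measure.map_id.symm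
    _ = φ.map fun _ _ => decide (p = 1) := Measure.map_congr h
    _ = _ := by rw [Measure.map_const, measure_univ, one_smul]

lemma SingleEdge.mem_rcSet (hequiv : Equivalence S) (hS : MeasRel S) (hp0 : 0 ≤ p) (hp1 : p ≤ 1)
    (hq : 0 < q) (hφ : SingleEdge S p q φ) : φ ∈ RCSet S p q := by
  refine ⟨inferInstance, fun Λ A hA B hB => ?_⟩
  by_cases hp : p = 0 ∨ p = 1
  · have hB' := outSigma_le Λ B hB
    classical
    rw [hφ.eq_dirac hp, setLIntegral_dirac, Measure.dirac_apply' _ (hA.inter hB'),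
      rcFin_const hp hq Λ hA, Set.indicator_apply, Set.indicator_apply,
      ← ite_and]
    simp only [Set.mem_inter_iff, and_comm]
  · rw [not_or] at hp
    exact hφ.measure_inter hequiv hS (lt_of_le_of_ne hp0 (Ne.symm hp.1)) (lt_of_le_of_ne hp1 hp.2)
      hq Λ hA hB

lemma SingleEdge.indep_iff (hS : MeasRel S) (hp0 : 0 < p) (hp1 : p < 1) (hq : 0 < q)
    (hq1 : q ≠ 1) (hφ : SingleEdge S p q φ) (e : Edge m) :
    (∀ B : Set (Config m), MeasurableSet[outSigmaE e] B →
      φ (JEdge e ∩ B) = ENNReal.ofReal (p / (p + q * (1 - p))) * φ B) ↔ φ (KEdge S e) = 0 := by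
  have hK := measurableSet_kEdge hS e
  constructor
  · intro h
    have h1 := h _ (measurableSet_outSigmaE_kEdge hS e)
    rw [hφ e _ (measurableSet_outSigmaE_kEdge hS e),
      setLIntegral_congr_fun (g := fun _ => ENNReal.ofReal p) hK fun ω hω => by
        simp only [openProb, if_pos hω], setLIntegral_const] at h1
    by_contra h0
    rw [ENNReal.mul_left_inj h0 (measure_ne_top φ _)] at h1
    have h2 : 0 < 1 - p := by linarith
    have h3 : 0 < p + q * (1 - p) := by positivity
    rw [ENNReal.ofReal_eq_ofReal_iff hp0.le (by positivity), eq_div_iff h3.ne'] at h1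
    have h4 : p * ((1 - p) * (q - 1)) = 0 := by linear_combination h1
    rw [mul_eq_zero, mul_eq_zero, sub_eq_zero] at h4
    rcases h4 with h4 | h4 | h4
    · exact hp0.ne' h4
    · exact hp1.ne' h4
    · exact hq1 (by linarith)
  · intro h0 B hB
    rw [hφ e B hB, ← setLIntegral_const]
    refine lintegral_congr_ae (ae_restrict_of_ae ?_)
    filter_upwards [measure_eq_zero_iff_ae_notMem.1 h0] with ω hω
    simp only [openProb, if_neg hω]

end

end

open Classical in
/-- (a) A probability measure `φ` is a `(∼)`random-cluster measure if and
only if its single-edge conditional probabilities given `T_e` equal `p` on `K^∼_e` and `π`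
off `K^∼_e`. (b) If moreover `p ∉ {0,1}` and `q ≠ 1`, and `φ ∈ R^∼_{p,q}`, then the state
of `e` is independent of the states of all other edges, equalling `1` with probability `π`,
if and only if `φ(K^∼_e) = 0`. -/
theorem single_edge_characterisation (m : ℕ) (hm : 2 ≤ m) (S : Ray m → Ray m → Prop)
    (hequiv : Equivalence S)
    (hmeas : ∀ Λ : Set (V m), Λ.Finite → ∀ u ∈ Λ, ∀ v ∈ Λ, MeasurableSet (KEvent S Λ u v))
    (p q : ℝ) (hp0 : 0 ≤ p) (hp1 : p ≤ 1) (hq : 0 < q)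
    (pi : ℝ) (hpi : pi = p / (p + q * (1 - p))) :
    (∀ φ : Measure (Config m), IsProbabilityMeasure φ →
      (φ ∈ RCSet S p q ↔
        ∀ e : Edge m, ∀ B : Set (Config m), MeasurableSet[outSigmaE e] B →
          φ (JEdge e ∩ B) =
            ∫⁻ ξ in B, (if ξ ∈ KEdge S e then ENNReal.ofReal p else ENNReal.ofReal pi) ∂φ)) ∧
    (p ≠ 0 → p ≠ 1 → q ≠ 1 → ∀ φ ∈ RCSet S p q, ∀ e : Edge m,
      ((∀ B : Set (Config m), MeasurableSet[outSigmaE e] B →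
          φ (JEdge e ∩ B) = ENNReal.ofReal pi * φ B) ↔ φ (KEdge S e) = 0)) := by
  subst hpi
  refine ⟨fun φ _ => ⟨fun h => singleEdge_of_mem_rcSet hequiv hp0 hp1 hq h,
    fun h => SingleEdge.mem_rcSet hequiv hmeas hp0 hp1 hq h⟩, fun hp hp' hq1 φ hφ e => ?_⟩
  have := hφ.1
  exact (singleEdge_of_mem_rcSet hequiv hp0 hp1 hq hφ).indep_iff hmeas
    (lt_of_le_of_ne hp0 hp.symm) (lt_of_le_of_ne hp1 hp') hq hq1 e

end RCTree
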